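/- Let H(a,b) = ζ(2,…,2,3,2,…,2) with a twos before the 3 and b twos after the 3, let c_{a,b}^r = C(2r,2a+2) − (1 − 1/2^{2r})·C(2r,2b+1), and let Ĥ(a,b) = 2∑_{r=1}^{a+b+1} (-1)^r c_{a,b}^r ζ(2r+1) ζ(2,…,2) (with a+b+1−r twos). Then the two generating functions F(x,y) = ∑_{a,b≥0} (-1)^{a+b+1} H(a,b) x^{2a+2} y^{2b+1} and F̂(x,y) = ∑_{a,b≥0} (-1)^{a+b+1} Ĥ(a,b) x^{2a+2} y^{2b+1} coincide: F(x,y) = F̂(x,y) for all real x, y with |x| < 1 and |y| < 1. -/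

import Mathlib

open scoped BigOperators

/-- The multiple zeta value `ζ(k 0, …, k (n-1))`. -/
noncomputable def mzv {n : ℕ} (k : Fin n → ℕ) : ℝ :=
  ∑' m : Fin n → ℕ+, if StrictMono m then ∏ i, (1 : ℝ) / ((m i : ℕ) : ℝ) ^ (k i) else 0

/-- The Riemann zeta value `ζ(k)` as a real series. -/
noncomputable def riemannZetaReal (k : ℕ) : ℝ := ∑' n : ℕ+, (1 : ℝ) / ((n : ℕ) : ℝ) ^ k

/-- `H a b = ζ(2,…,2,3,2,…,2)` with `a` twos before the `3` and `b` twos after. -/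
noncomputable def Hmzv (a b : ℕ) : ℝ :=
  mzv (fun i : Fin (a + b + 1) => if (i : ℕ) = a then 3 else 2)

/-- The coefficient `c_{a,b}^r = C(2r,2a+2) − (1 − 1/2^{2r}) C(2r,2b+1)`. -/
noncomputable def cCoeff (a b r : ℕ) : ℝ :=
  (Nat.choose (2 * r) (2 * a + 2) : ℝ) -
    (1 - 1 / 2 ^ (2 * r)) * (Nat.choose (2 * r) (2 * b + 1) : ℝ)

/-- `Ĥ(a,b) = 2 ∑_{r=1}^{a+b+1} (-1)^r c_{a,b}^r ζ(2r+1) ζ(2,…,2)` with `a+b+1−r` twos. -/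
noncomputable def Hhat (a b : ℕ) : ℝ :=
  2 * ∑ r ∈ Finset.Icc 1 (a + b + 1),
    (-1 : ℝ) ^ r * cCoeff a b r * riemannZetaReal (2 * r + 1) *
      mzv (fun _ : Fin (a + b + 1 - r) => 2)

/-- The generating function `F(x,y)`. -/
noncomputable def Fgen (x y : ℝ) : ℝ :=
  ∑' a : ℕ, ∑' b : ℕ, (-1 : ℝ) ^ (a + b + 1) * Hmzv a b * x ^ (2 * a + 2) * y ^ (2 * b + 1)

/-- The generating function `F̂(x,y)`. -/
noncomputable def FhatGen (x y : ℝ) : ℝ :=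
  ∑' a : ℕ, ∑' b : ℕ, (-1 : ℝ) ^ (a + b + 1) * Hhat a b * x ^ (2 * a + 2) * y ^ (2 * b + 1)

open Filter Topology MeasureTheory
open scoped ENNReal Interval

/-- The multiple zeta tail `∑_{M < m_1 < ⋯ < m_n} ∏ m_i ^ (-k_i)`, for the list `[k_1, …, k_n]`. -/
noncomputable def mzvTail : List ℕ → ℕ → ℝ≥0∞
  | [], _ => 1
  | k :: l, M => ∑' p : ℕ+, if M < (p : ℕ) then (((p : ℕ) : ℝ≥0∞) ^ k)⁻¹ * mzvTail l p else 0

theorem strictMono_cons_and_lt_iff {n : ℕ} (p : ℕ+) (m : Fin n → ℕ+) (M : ℕ) :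
    (StrictMono (Fin.cons p m : Fin (n + 1) → ℕ+) ∧
      ∀ i, M < ((Fin.cons p m : Fin (n + 1) → ℕ+) i : ℕ)) ↔
      M < (p : ℕ) ∧ StrictMono m ∧ ∀ i, (p : ℕ) < (m i : ℕ) := by
  constructor
  · rintro ⟨h, h'⟩
    refine ⟨by simpa using h' 0, fun i j hij => ?_, fun i => ?_⟩
    · simpa using h (Fin.succ_lt_succ_iff.mpr hij)
    · simpa using h (Fin.succ_pos i)
  · rintro ⟨h, hm, hp⟩
    refine ⟨fun i j hij => ?_, fun i => ?_⟩
    · induction i using Fin.cases with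
      | zero =>
        induction j using Fin.cases with
        | zero => exact absurd hij (lt_irrefl _)
        | succ j => simpa using hp j
      | succ i =>
        induction j using Fin.cases with
        | zero => exact absurd hij (Fin.not_lt_zero _)
        | succ j => simpa using hm (Fin.succ_lt_succ_iff.mp hij)
    · induction i using Fin.cases with
      | zero => simpa using h
      | succ i => simpa using h.trans (hp i)

open Classical in
theorem tsum_strictMono_eq_mzvTail {n : ℕ} (k : Fin n → ℕ) (M : ℕ) :
    (∑' m : Fin n → ℕ+, if StrictMono m ∧ ∀ i, M < (m i : ℕ) then
      ∏ i, (((m i : ℕ) : ℝ≥0∞) ^ k i)⁻¹ else 0) = mzvTail (List.ofFn k) M := by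
  induction n generalizing M with
  | zero =>
    rw [tsum_eq_single (default : Fin 0 → ℕ+) (fun b hb => absurd (Subsingleton.elim _ _) hb)]
    simp [mzvTail, Subsingleton.strictMono]
  | succ n ih =>
    rw [List.ofFn_succ, mzvTail, ← (Fin.consEquiv fun _ => ℕ+).tsum_eq, ENNReal.tsum_prod']
    refine tsum_congr fun p => ?_
    rw [← ih, ← ENNReal.tsum_mul_left]
    rw [show (if M < (p : ℕ) then ∑' m : Fin n → ℕ+, ((((p : ℕ) : ℝ≥0∞) ^ k 0)⁻¹ *
      if StrictMono m ∧ ∀ i, (p : ℕ) < (m i : ℕ) then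
        ∏ i, (((m i : ℕ) : ℝ≥0∞) ^ k i.succ)⁻¹ else 0) else 0) =
        ∑' m : Fin n → ℕ+, if M < (p : ℕ) then ((((p : ℕ) : ℝ≥0∞) ^ k 0)⁻¹ *
      if StrictMono m ∧ ∀ i, (p : ℕ) < (m i : ℕ) then
        ∏ i, (((m i : ℕ) : ℝ≥0∞) ^ k i.succ)⁻¹ else 0) else 0 by split_ifs <;> simp]
    refine tsum_congr fun m => ?_
    change (if StrictMono (Fin.cons p m : Fin (n + 1) → ℕ+) ∧
      ∀ i, M < ((Fin.cons p m : Fin (n + 1) → ℕ+) i : ℕ) then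
      ∏ i, ((((Fin.cons p m : Fin (n + 1) → ℕ+) i : ℕ) : ℝ≥0∞) ^ k i)⁻¹ else 0) = _
    simp only [strictMono_cons_and_lt_iff, Fin.prod_univ_succ, Fin.cons_zero, Fin.cons_succ,
      ite_and, mul_ite, mul_zero]

theorem mzv_eq_toReal {n : ℕ} (k : Fin n → ℕ) : mzv k = (mzvTail (List.ofFn k) 0).toReal := by
  classical
  rw [← tsum_strictMono_eq_mzvTail, ENNReal.tsum_toReal_eq, mzv]
  · refine tsum_congr fun m => ?_
    simp only [PNat.pos, implies_true, and_true]
    split_ifs <;> simp [ENNReal.toReal_prod]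
  · intro m
    split_ifs
    · exact ENNReal.prod_ne_top fun i _ => by simp
    · simp

theorem mzvTail_cons_succ (k : ℕ) (l : List ℕ) (M : ℕ) :
    mzvTail (k :: l) M =
      (((M + 1 : ℕ) : ℝ≥0∞) ^ k)⁻¹ * mzvTail l (M + 1) + mzvTail (k :: l) (M + 1) := by
  have hM := tsum_ite_eq (M.succPNat) (fun p : ℕ+ => (((p : ℕ) : ℝ≥0∞) ^ k)⁻¹ * mzvTail l p)
  rw [Nat.succPNat_coe, Nat.succ_eq_add_one] at hM
  rw [mzvTail, mzvTail, ← hM, ← ENNReal.tsum_add]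
  refine tsum_congr fun p => ?_
  rcases lt_trichotomy (p : ℕ) (M + 1) with h | h | h
  · have : p ≠ M.succPNat := fun e => by simp [e] at h
    rw [if_neg (by omega), if_neg this, if_neg (by omega), add_zero]
  · have : p = M.succPNat := PNat.coe_injective (by simpa using h)
    rw [if_pos (by omega), if_pos this, if_neg (by omega), add_zero]
  · have : p ≠ M.succPNat := fun e => by simp [e] at h
    rw [if_pos (by omega), if_neg this, if_pos (by omega), zero_add]

theorem mzvTail_anti (l : List ℕ) {M N : ℕ} (h : M ≤ N) : mzvTail l N ≤ mzvTail l M := by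
  cases l with
  | nil => simp [mzvTail]
  | cons k l =>
    rw [mzvTail, mzvTail]
    refine ENNReal.tsum_le_tsum fun p => ?_
    split_ifs with h₁ h₂
    · exact le_rfl
    · omega
    · exact zero_le
    · exact le_rfl

theorem mzvTail_le_pow {l : List ℕ} (hl : ∀ k ∈ l, 2 ≤ k) (M : ℕ) :
    mzvTail l M ≤ mzvTail [2] M ^ l.length := by
  induction l generalizing M with
  | nil => simp [mzvTail]
  | cons k l ih =>
    have h2 : mzvTail [2] M = ∑' p : ℕ+, if M < (p : ℕ) then (((p : ℕ) : ℝ≥0∞) ^ 2)⁻¹ else 0 := by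
      simp [mzvTail]
    rw [List.length_cons, pow_succ', mzvTail]
    nth_rw 1 [h2]
    rw [← ENNReal.tsum_mul_right]
    refine ENNReal.tsum_le_tsum fun p => ?_
    split_ifs with hp
    · refine mul_le_mul' ?_ ?_
      · refine ENNReal.inv_le_inv.mpr (pow_le_pow_right₀ ?_ (hl k (by simp)))
        exact_mod_cast p.pos
      · refine (ih (fun j hj => hl j (by simp [hj])) p).trans ?_
        gcongr
        exact mzvTail_anti [2] hp.le
    · exact zero_le

theorem sum_range_ite_inv_sq_le (M n : ℕ) :
    (∑ k ∈ Finset.range n, if M < k + 1 then (((k : ℝ) + 1) ^ 2)⁻¹ else 0) +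
      2 / ((max n M : ℕ) + 1 : ℝ) ≤ 2 / ((M : ℝ) + 1) := by
  induction n with
  | zero => simp
  | succ n ih =>
    rw [Finset.sum_range_succ]
    refine le_trans ?_ ih
    rw [add_assoc]
    refine add_le_add le_rfl ?_
    split_ifs with h
    · rw [max_eq_left (by omega), max_eq_left (by omega)]
      push_cast
      have hn : (0 : ℝ) ≤ n := Nat.cast_nonneg n
      rw [← sub_nonneg]
      have : 2 / ((n : ℝ) + 1) - ((((n : ℝ) + 1) ^ 2)⁻¹ + 2 / ((n : ℝ) + 1 + 1)) =
          n / (((n : ℝ) + 1) ^ 2 * (n + 1 + 1)) := by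
        field_simp
        ring
      rw [this]
      positivity
    · rw [max_eq_right (by omega), max_eq_right (by omega), zero_add]

theorem mzvTail_two_le (M : ℕ) : mzvTail [2] M ≤ ENNReal.ofReal (2 / ((M : ℝ) + 1)) := by
  have h2 : mzvTail [2] M =
      ∑' k : ℕ, if M < k + 1 then (((k + 1 : ℕ) : ℝ≥0∞) ^ 2)⁻¹ else 0 := by
    simp only [mzvTail, mul_one]
    exact tsum_pnat_eq_tsum_succ (f := fun p : ℕ => if M < p then ((p : ℝ≥0∞) ^ 2)⁻¹ else 0)
  rw [h2]
  refine ENNReal.tsum_le_of_sum_range_le fun n => ?_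
  have hterm : ∀ k : ℕ, (if M < k + 1 then (((k + 1 : ℕ) : ℝ≥0∞) ^ 2)⁻¹ else 0) =
      ENNReal.ofReal (if M < k + 1 then (((k : ℝ) + 1) ^ 2)⁻¹ else 0) := by
    intro k
    split_ifs
    · rw [ENNReal.ofReal_inv_of_pos (by positivity), ENNReal.ofReal_pow (by positivity)]
      congr 2
      rw [← ENNReal.ofReal_natCast]
      push_cast
      rfl
    · simp
  simp_rw [hterm]
  rw [← ENNReal.ofReal_sum_of_nonneg (fun k _ => by split_ifs <;> positivity)]
  refine ENNReal.ofReal_le_ofReal ?_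
  have := sum_range_ite_inv_sq_le M n
  have h0 : (0 : ℝ) ≤ 2 / ((max n M : ℕ) + 1 : ℝ) := by positivity
  linarith

theorem mzvTail_le_ofReal_pow {l : List ℕ} (hl : ∀ k ∈ l, 2 ≤ k) (M : ℕ) :
    mzvTail l M ≤ ENNReal.ofReal ((2 / ((M : ℝ) + 1)) ^ l.length) := by
  rw [ENNReal.ofReal_pow (by positivity)]
  exact (mzvTail_le_pow hl M).trans (pow_le_pow_left' (mzvTail_two_le M) _)

theorem mzvTail_ne_top {l : List ℕ} (hl : ∀ k ∈ l, 2 ≤ k) (M : ℕ) : mzvTail l M ≠ ∞ :=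
  ((mzvTail_le_ofReal_pow hl M).trans_lt ENNReal.ofReal_lt_top).ne

theorem toReal_mzvTail_le {l : List ℕ} (hl : ∀ k ∈ l, 2 ≤ k) (M : ℕ) :
    (mzvTail l M).toReal ≤ (2 / ((M : ℝ) + 1)) ^ l.length :=
  ENNReal.toReal_le_of_le_ofReal (by positivity) (mzvTail_le_ofReal_pow hl M)

theorem toReal_mzvTail_cons_succ {k : ℕ} {l : List ℕ} (hl : ∀ j ∈ k :: l, 2 ≤ j) (M : ℕ) :
    (mzvTail (k :: l) M).toReal = (mzvTail l (M + 1)).toReal / ((M : ℝ) + 1) ^ k +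
      (mzvTail (k :: l) (M + 1)).toReal := by
  have h := mzvTail_ne_top (M := M + 1) fun j hj => hl j (List.mem_cons_of_mem _ hj)
  rw [mzvTail_cons_succ, ENNReal.toReal_add (ENNReal.mul_ne_top (by simp) h)
    (mzvTail_ne_top hl _), ENNReal.toReal_mul]
  rw [ENNReal.toReal_inv, ENNReal.toReal_pow, ENNReal.toReal_natCast, div_eq_inv_mul]
  push_cast
  rfl

/-- The tail `∑_{M < m_1 < ⋯ < m_b} ∏ m_i ^ (-2)`. -/
noncomputable def twosTail (b M : ℕ) : ℝ := (mzvTail (List.replicate b 2) M).toReal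

/-- The tail of the series of `ζ(2,…,2,3,2,…,2)` over indices exceeding `M`. -/
noncomputable def hTail (a b M : ℕ) : ℝ :=
  (mzvTail (List.replicate a 2 ++ 3 :: List.replicate b 2) M).toReal

theorem mzv_two_eq (j : ℕ) : mzv (fun _ : Fin j => 2) = twosTail j 0 := by
  rw [mzv_eq_toReal, List.ofFn_const, twosTail]

theorem Hmzv_eq (a b : ℕ) : Hmzv a b = hTail a b 0 := by
  rw [Hmzv, mzv_eq_toReal, hTail]
  congr 2
  refine List.ext_getElem (by simp; omega) fun i h₁ h₂ => ?_
  simp only [List.getElem_ofFn, List.getElem_append, List.getElem_cons, List.getElem_replicate,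
    List.length_replicate]
  split_ifs <;> omega

theorem twosTail_nonneg (b M : ℕ) : 0 ≤ twosTail b M := ENNReal.toReal_nonneg

theorem hTail_nonneg (a b M : ℕ) : 0 ≤ hTail a b M := ENNReal.toReal_nonneg

theorem twosTail_zero (M : ℕ) : twosTail 0 M = 1 := by simp [twosTail, mzvTail]

theorem twosTail_succ (b M : ℕ) : twosTail (b + 1) M =
    twosTail b (M + 1) / ((M : ℝ) + 1) ^ 2 + twosTail (b + 1) (M + 1) := by
  simp only [twosTail, List.replicate_succ]
  exact toReal_mzvTail_cons_succ (by simp) M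

theorem hTail_zero (b M : ℕ) : hTail 0 b M =
    twosTail b (M + 1) / ((M : ℝ) + 1) ^ 3 + hTail 0 b (M + 1) := by
  simp only [twosTail, hTail, List.replicate_zero, List.nil_append]
  exact toReal_mzvTail_cons_succ (by simp) M

theorem hTail_succ (a b M : ℕ) : hTail (a + 1) b M =
    hTail a b (M + 1) / ((M : ℝ) + 1) ^ 2 + hTail (a + 1) b (M + 1) := by
  simp only [hTail, List.replicate_succ, List.cons_append]
  refine toReal_mzvTail_cons_succ ?_ M
  simp only [List.mem_cons, List.mem_append, List.mem_replicate]
  omega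

theorem twosTail_le (b M : ℕ) : twosTail b M ≤ (2 / ((M : ℝ) + 1)) ^ b := by
  simpa [twosTail] using toReal_mzvTail_le (l := List.replicate b 2) (by simp) M

theorem hTail_le (a b M : ℕ) : hTail a b M ≤ (2 / ((M : ℝ) + 1)) ^ (a + b + 1) := by
  have := toReal_mzvTail_le (l := List.replicate a 2 ++ 3 :: List.replicate b 2) (by
    simp only [List.mem_cons, List.mem_append, List.mem_replicate]
    omega) M
  simpa [hTail, add_assoc] using this

theorem tendsto_two_div_pow {n : ℕ} (hn : n ≠ 0) :
    Tendsto (fun M : ℕ => (2 / ((M : ℝ) + 1)) ^ n) atTop (𝓝 0) := by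
  have h : Tendsto (fun M : ℕ => 2 * (1 / ((M : ℝ) + 1))) atTop (𝓝 (2 * 0)) :=
    tendsto_one_div_add_atTop_nhds_zero_nat.const_mul 2
  simpa [hn, div_eq_mul_inv] using h.pow n

theorem two_div_le (M : ℕ) : 2 / ((M : ℝ) + 1) ≤ 2 :=
  div_le_self (by norm_num) (by linarith [Nat.cast_nonneg (α := ℝ) M])

/-- The generating function `∑_b (-1)^b twosTail b M y^(2b) = ∏_{k > M} (1 - y²/k²)`. -/
noncomputable def twosGen (y : ℝ) (M : ℕ) : ℝ := ∑' b : ℕ, (-1) ^ b * twosTail b M * y ^ (2 * b)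

theorem norm_twosGen_term_le (y : ℝ) (M b : ℕ) :
    ‖(-1) ^ b * twosTail b M * y ^ (2 * b)‖ ≤ (2 * y ^ 2) ^ b := by
  have h : ‖y ^ (2 * b)‖ = (y ^ 2) ^ b := by
    rw [pow_mul, Real.norm_of_nonneg (by positivity)]
  rw [norm_mul, norm_mul, norm_pow, norm_neg, norm_one, one_pow, one_mul, h, mul_pow,
    Real.norm_of_nonneg (twosTail_nonneg _ _)]
  gcongr
  exact (twosTail_le b M).trans (pow_le_pow_left₀ (by positivity) (two_div_le M) b)

theorem summable_norm_twosGen_term {y : ℝ} (hy : 2 * y ^ 2 < 1) (M : ℕ) :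
    Summable fun b : ℕ => ‖(-1) ^ b * twosTail b M * y ^ (2 * b)‖ :=
  .of_nonneg_of_le (fun _ => norm_nonneg _) (norm_twosGen_term_le y M)
    (summable_geometric_of_lt_one (by positivity) hy)

theorem hasSum_twosGen {y : ℝ} (hy : 2 * y ^ 2 < 1) (M : ℕ) :
    HasSum (fun b : ℕ => (-1) ^ b * twosTail b M * y ^ (2 * b)) (twosGen y M) :=
  (summable_norm_twosGen_term hy M).of_norm.hasSum

theorem twosGen_eq_mul {y : ℝ} (hy : 2 * y ^ 2 < 1) (M : ℕ) :
    twosGen y M = (1 - y ^ 2 / ((M : ℝ) + 1) ^ 2) * twosGen y (M + 1) := by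
  have h₁ := (summable_norm_twosGen_term hy M).of_norm
  have h₂ := (summable_norm_twosGen_term hy (M + 1)).of_norm
  rw [sub_mul, one_mul, twosGen, twosGen, h₁.tsum_eq_zero_add]
  nth_rw 1 [h₂.tsum_eq_zero_add]
  rw [← tsum_mul_left, twosTail_zero, twosTail_zero, add_sub_assoc,
    ← ((summable_nat_add_iff 1).mpr h₂).tsum_sub (h₂.mul_left _)]
  congr 1
  refine tsum_congr fun b => ?_
  rw [twosTail_succ]
  ring

theorem tendsto_twosGen {y : ℝ} (hy : 2 * y ^ 2 < 1) : Tendsto (twosGen y) atTop (𝓝 1) := by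
  have h := tendsto_tsum_of_dominated_convergence (𝓕 := atTop)
    (f := fun M b : ℕ => (-1) ^ b * twosTail b M * y ^ (2 * b))
    (g := fun b => if b = 0 then 1 else 0) (bound := fun b => (2 * y ^ 2) ^ b)
    (summable_geometric_of_lt_one (by positivity) hy) (fun b => ?_)
    (Eventually.of_forall fun M b => norm_twosGen_term_le y M b)
  · rw [tsum_ite_eq] at h
    exact h
  · split_ifs with hb
    · simp [hb, twosTail_zero]
    · have h0 := squeeze_zero (fun M => twosTail_nonneg b M) (fun M => twosTail_le b M)
        (tendsto_two_div_pow hb)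
      simpa using (h0.const_mul ((-1) ^ b)).mul_const (y ^ (2 * b))

theorem twosGen_zero_eq_prod_mul {y : ℝ} (hy : 2 * y ^ 2 < 1) (M : ℕ) :
    twosGen y 0 = (∏ j ∈ Finset.range M, (1 - y ^ 2 / ((j : ℝ) + 1) ^ 2)) * twosGen y M := by
  induction M with
  | zero => simp
  | succ M ih => rw [Finset.prod_range_succ, mul_assoc, ← twosGen_eq_mul hy, ih]

theorem pi_mul_twosGen_zero {y : ℝ} (hy : 2 * y ^ 2 < 1) :
    Real.pi * y * twosGen y 0 = Real.sin (Real.pi * y) := by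
  refine tendsto_nhds_unique tendsto_const_nhds ?_ (f := fun _ : ℕ => Real.pi * y * twosGen y 0)
    (l := atTop)
  have h := (Real.tendsto_euler_sin_prod y).mul (tendsto_twosGen hy)
  rw [mul_one] at h
  refine h.congr fun M => ?_
  rw [twosGen_zero_eq_prod_mul hy M]
  ring

/-- The generating function of `hTail a b M` in the variable attached to `b`. -/
noncomputable def hGenRow (y : ℝ) (a M : ℕ) : ℝ := ∑' b : ℕ, (-1) ^ b * hTail a b M * y ^ (2 * b)

/-- The double generating function of `hTail a b M`. -/
noncomputable def hGen (x y : ℝ) (M : ℕ) : ℝ := ∑' a : ℕ, (-1) ^ a * hGenRow y a M * x ^ (2 * a)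

theorem norm_hGenRow_term_le (y : ℝ) (a M b : ℕ) :
    ‖(-1) ^ b * hTail a b M * y ^ (2 * b)‖ ≤ (2 / ((M : ℝ) + 1)) ^ (a + 1) * (2 * y ^ 2) ^ b := by
  have h : ‖y ^ (2 * b)‖ = (y ^ 2) ^ b := by
    rw [pow_mul, Real.norm_of_nonneg (by positivity)]
  rw [norm_mul, norm_mul, norm_pow, norm_neg, norm_one, one_pow, one_mul, h, mul_pow,
    Real.norm_of_nonneg (hTail_nonneg _ _ _), ← mul_assoc]
  gcongr
  refine (hTail_le a b M).trans ?_
  rw [show a + b + 1 = a + 1 + b by ring, pow_add]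
  gcongr
  exact two_div_le M

theorem summable_hGenRow_term {y : ℝ} (hy : 2 * y ^ 2 < 1) (a M : ℕ) :
    Summable fun b : ℕ => (-1) ^ b * hTail a b M * y ^ (2 * b) :=
  .of_norm_bounded ((summable_geometric_of_lt_one (by positivity) hy).mul_left _)
    (norm_hGenRow_term_le y a M)

theorem norm_hGenRow_le {y : ℝ} (hy : 2 * y ^ 2 < 1) (a M : ℕ) :
    ‖hGenRow y a M‖ ≤ (2 / ((M : ℝ) + 1)) ^ (a + 1) * (1 - 2 * y ^ 2)⁻¹ :=
  tsum_of_norm_bounded ((hasSum_geometric_of_lt_one (by positivity) hy).mul_left _)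
    (norm_hGenRow_term_le y a M)

theorem norm_hGen_term_le {x y : ℝ} (hy : 2 * y ^ 2 < 1) (a M : ℕ) :
    ‖(-1) ^ a * hGenRow y a M * x ^ (2 * a)‖ ≤
      2 * (1 - 2 * y ^ 2)⁻¹ * (2 * x ^ 2) ^ a := by
  have h : ‖x ^ (2 * a)‖ = (x ^ 2) ^ a := by
    rw [pow_mul, Real.norm_of_nonneg (by positivity)]
  have hy' : 0 < 1 - 2 * y ^ 2 := by linarith
  rw [norm_mul, norm_mul, norm_pow, norm_neg, norm_one, one_pow, one_mul, h, mul_pow]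
  calc ‖hGenRow y a M‖ * (x ^ 2) ^ a
      ≤ (2 ^ (a + 1) * (1 - 2 * y ^ 2)⁻¹) * (x ^ 2) ^ a := by
        gcongr
        refine (norm_hGenRow_le hy a M).trans ?_
        gcongr
        exact two_div_le M
    _ = _ := by ring

theorem summable_hGen_term {x y : ℝ} (hx : 2 * x ^ 2 < 1) (hy : 2 * y ^ 2 < 1) (M : ℕ) :
    Summable fun a : ℕ => (-1) ^ a * hGenRow y a M * x ^ (2 * a) :=
  .of_norm_bounded ((summable_geometric_of_lt_one (by positivity) hx).mul_left _)
    (fun a => norm_hGen_term_le hy a M)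

theorem hGenRow_zero {y : ℝ} (hy : 2 * y ^ 2 < 1) (M : ℕ) :
    hGenRow y 0 M = twosGen y (M + 1) / ((M : ℝ) + 1) ^ 3 + hGenRow y 0 (M + 1) := by
  rw [hGenRow, hGenRow, twosGen, ← tsum_div_const,
    ← ((hasSum_twosGen hy (M + 1)).summable.div_const _).tsum_add (summable_hGenRow_term hy 0 _)]
  refine tsum_congr fun b => ?_
  rw [hTail_zero]
  ring

theorem hGenRow_succ {y : ℝ} (hy : 2 * y ^ 2 < 1) (a M : ℕ) :
    hGenRow y (a + 1) M =
      hGenRow y a (M + 1) / ((M : ℝ) + 1) ^ 2 + hGenRow y (a + 1) (M + 1) := by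
  rw [hGenRow, hGenRow, hGenRow, ← tsum_div_const,
    ← ((summable_hGenRow_term hy a (M + 1)).div_const _).tsum_add
      (summable_hGenRow_term hy (a + 1) _)]
  refine tsum_congr fun b => ?_
  rw [hTail_succ]
  ring

theorem hGen_eq {x y : ℝ} (hx : 2 * x ^ 2 < 1) (hy : 2 * y ^ 2 < 1) (M : ℕ) :
    hGen x y M = twosGen y (M + 1) / ((M : ℝ) + 1) ^ 3 +
      (1 - x ^ 2 / ((M : ℝ) + 1) ^ 2) * hGen x y (M + 1) := by
  have h₁ := summable_hGen_term hx hy M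
  have h₂ := summable_hGen_term hx hy (M + 1)
  rw [sub_mul, one_mul, hGen, hGen, h₁.tsum_eq_zero_add]
  nth_rw 1 [h₂.tsum_eq_zero_add]
  rw [← tsum_mul_left, hGenRow_zero hy, add_sub_assoc,
    ← ((summable_nat_add_iff 1).mpr h₂).tsum_sub (h₂.mul_left _)]
  have : ∀ a : ℕ, (-1) ^ (a + 1) * hGenRow y (a + 1) M * x ^ (2 * (a + 1)) =
      (-1) ^ (a + 1) * hGenRow y (a + 1) (M + 1) * x ^ (2 * (a + 1)) -
        x ^ 2 / ((M : ℝ) + 1) ^ 2 * ((-1) ^ a * hGenRow y a (M + 1) * x ^ (2 * a)) := by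
    intro a
    rw [hGenRow_succ hy]
    ring
  rw [tsum_congr this]
  ring

theorem tendsto_hGen {x y : ℝ} (hx : 2 * x ^ 2 < 1) (hy : 2 * y ^ 2 < 1) :
    Tendsto (hGen x y) atTop (𝓝 0) := by
  have h := tendsto_tsum_of_dominated_convergence (𝓕 := atTop)
    (f := fun M a : ℕ => (-1) ^ a * hGenRow y a M * x ^ (2 * a))
    (g := fun _ => 0) (bound := fun a => 2 * (1 - 2 * y ^ 2)⁻¹ * (2 * x ^ 2) ^ a)
    ((summable_geometric_of_lt_one (by positivity) hx).mul_left _) (fun a => ?_)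
    (Eventually.of_forall fun M a => norm_hGen_term_le hy a M)
  · rw [tsum_zero] at h
    exact h
  · have h0 : Tendsto (fun M : ℕ => hGenRow y a M) atTop (𝓝 0) := by
      refine squeeze_zero_norm (fun M => norm_hGenRow_le hy a M) ?_
      simpa using (tendsto_two_div_pow a.succ_ne_zero).mul_const ((1 - 2 * y ^ 2)⁻¹)
    simpa using (h0.const_mul ((-1) ^ a)).mul_const (x ^ (2 * a))

theorem hGen_zero_eq_sum_add {x y : ℝ} (hx : 2 * x ^ 2 < 1) (hy : 2 * y ^ 2 < 1) (N : ℕ) :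
    hGen x y 0 = ∑ m ∈ Finset.range N, (∏ j ∈ Finset.range m, (1 - x ^ 2 / ((j : ℝ) + 1) ^ 2)) *
      (twosGen y (m + 1) / ((m : ℝ) + 1) ^ 3) +
      (∏ j ∈ Finset.range N, (1 - x ^ 2 / ((j : ℝ) + 1) ^ 2)) * hGen x y N := by
  induction N with
  | zero => simp
  | succ N ih =>
    rw [ih, Finset.sum_range_succ, Finset.prod_range_succ, hGen_eq hx hy N]
    ring

theorem one_sub_div_sq_mem {x : ℝ} (hx : 2 * x ^ 2 < 1) (j : ℕ) :
    0 ≤ 1 - x ^ 2 / ((j : ℝ) + 1) ^ 2 ∧ 1 - x ^ 2 / ((j : ℝ) + 1) ^ 2 ≤ 1 := by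
  have hj : (0 : ℝ) ≤ j := Nat.cast_nonneg j
  have h1 : x ^ 2 / ((j : ℝ) + 1) ^ 2 ≤ 1 := by
    rw [div_le_one (by positivity)]
    nlinarith
  have h0 : 0 ≤ x ^ 2 / ((j : ℝ) + 1) ^ 2 := by positivity
  constructor <;> linarith

theorem tendsto_sum_hGen {x y : ℝ} (hx : 2 * x ^ 2 < 1) (hy : 2 * y ^ 2 < 1) :
    Tendsto (fun N : ℕ => ∑ m ∈ Finset.range N,
      (∏ j ∈ Finset.range m, (1 - x ^ 2 / ((j : ℝ) + 1) ^ 2)) *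
      (twosGen y (m + 1) / ((m : ℝ) + 1) ^ 3)) atTop (𝓝 (hGen x y 0)) := by
  have h0 : Tendsto (fun N : ℕ => (∏ j ∈ Finset.range N, (1 - x ^ 2 / ((j : ℝ) + 1) ^ 2)) *
      hGen x y N) atTop (𝓝 0) := by
    refine squeeze_zero_norm (fun N => ?_) (tendsto_zero_iff_norm_tendsto_zero.mp
      (tendsto_hGen hx hy))
    rw [norm_mul]
    refine mul_le_of_le_one_left (norm_nonneg _) ?_
    rw [Real.norm_of_nonneg (Finset.prod_nonneg fun j _ => (one_sub_div_sq_mem hx j).1)]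
    exact Finset.prod_le_one (fun j _ => (one_sub_div_sq_mem hx j).1)
      fun j _ => (one_sub_div_sq_mem hx j).2
  have h := (tendsto_const_nhds (x := hGen x y 0)).sub h0
  rw [sub_zero] at h
  refine h.congr fun N => ?_
  rw [hGen_zero_eq_sum_add hx hy N]
  ring

theorem hasSum_hGen {x y : ℝ} (hx : 2 * x ^ 2 < 1) (hy : 2 * y ^ 2 < 1) :
    HasSum (fun p : ℕ × ℕ => (-1) ^ (p.1 + p.2) * hTail p.1 p.2 0 * x ^ (2 * p.1) * y ^ (2 * p.2))
      (hGen x y 0) := by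
  have hs : Summable fun p : ℕ × ℕ =>
      (-1) ^ (p.1 + p.2) * hTail p.1 p.2 0 * x ^ (2 * p.1) * y ^ (2 * p.2) := by
    refine .of_norm_bounded (g := fun p : ℕ × ℕ => (2 * (2 * x ^ 2) ^ p.1) * (2 * y ^ 2) ^ p.2)
      (((summable_geometric_of_lt_one (by positivity) hx).mul_left 2).mul_of_nonneg
        (summable_geometric_of_lt_one (by positivity) hy) (fun a => by positivity)
        (fun b => by positivity)) fun ⟨a, b⟩ => ?_
    have h : ‖x ^ (2 * a)‖ = (x ^ 2) ^ a := by
      rw [pow_mul, Real.norm_of_nonneg (by positivity)]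
    calc _ = ‖(-1) ^ b * hTail a b 0 * y ^ (2 * b)‖ * (x ^ 2) ^ a := by
          rw [← h, ← norm_mul]
          simp only [norm_mul, norm_pow, norm_neg, norm_one, one_pow]
          ring
      _ ≤ ((2 / (((0 : ℕ) : ℝ) + 1)) ^ (a + 1) * (2 * y ^ 2) ^ b) * (x ^ 2) ^ a := by
          gcongr
          exact norm_hGenRow_term_le y a 0 b
      _ = _ := by
          simp only [Nat.cast_zero, zero_add, div_one]
          ring
  have ht := hs.hasSum
  rw [hs.tsum_prod] at ht
  convert ht using 1
  rw [hGen]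
  refine tsum_congr fun a => ?_
  rw [hGenRow, mul_assoc, mul_comm _ (x ^ (2 * a)), ← mul_assoc, ← tsum_mul_left]
  exact tsum_congr fun b => by ring

/-- `cosCoeff x m` is minus the coefficient of `sin θ ^ (2m+2)` in the expansion of `cos (2xθ)`. -/
noncomputable def cosCoeff (x : ℝ) : ℕ → ℝ
  | 0 => 2 * x ^ 2
  | m + 1 => cosCoeff x m * (4 * ((m : ℝ) + 1) ^ 2 - 4 * x ^ 2) / ((2 * m + 4) * (2 * m + 3))

theorem cosCoeff_nonneg {x : ℝ} (hx : x ^ 2 ≤ 1) (m : ℕ) : 0 ≤ cosCoeff x m := by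
  induction m with
  | zero => simp only [cosCoeff]; positivity
  | succ m ih =>
    have hm : (0 : ℝ) ≤ m := Nat.cast_nonneg m
    have : 0 ≤ 4 * ((m : ℝ) + 1) ^ 2 - 4 * x ^ 2 := by nlinarith
    rw [cosCoeff]
    positivity

theorem cosCoeff_mul_le {x : ℝ} (hx : x ^ 2 ≤ 1) (m : ℕ) :
    cosCoeff x m * ((m : ℝ) + 1) ≤ 2 * x ^ 2 := by
  induction m with
  | zero => simp [cosCoeff]
  | succ m ih =>
    have hm : (0 : ℝ) ≤ m := Nat.cast_nonneg m
    refine le_trans ?_ ih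
    rw [cosCoeff, div_mul_eq_mul_div, div_le_iff₀ (by positivity), mul_assoc, mul_assoc]
    refine mul_le_mul_of_nonneg_left ?_ (cosCoeff_nonneg hx m)
    push_cast
    nlinarith [mul_nonneg hm (sq_nonneg x), sq_nonneg x, mul_nonneg hm hm]

/-- Partial sums of the expansion of `cos (2xθ)` in powers of `sin θ`. -/
noncomputable def cosPartial (x : ℝ) (N : ℕ) (θ : ℝ) : ℝ :=
  1 - ∑ m ∈ Finset.range N, cosCoeff x m * Real.sin θ ^ (2 * m + 2)

/-- The derivative of `cosPartial`. -/
noncomputable def cosPartialDeriv (x : ℝ) (N : ℕ) (θ : ℝ) : ℝ :=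
  -∑ m ∈ Finset.range N, cosCoeff x m * ((2 * m + 2) * (Real.sin θ ^ (2 * m + 1) * Real.cos θ))

theorem hasDerivAt_cosPartial (x : ℝ) (N : ℕ) (θ : ℝ) :
    HasDerivAt (cosPartial x N) (cosPartialDeriv x N θ) θ := by
  have h : ∀ m ∈ Finset.range N, HasDerivAt
      (fun θ => cosCoeff x m * Real.sin θ ^ (2 * m + 2))
      (cosCoeff x m * ((2 * m + 2) * (Real.sin θ ^ (2 * m + 1) * Real.cos θ))) θ := by
    intro m _
    convert! ((Real.hasDerivAt_sin θ).pow (2 * m + 2)).const_mul (cosCoeff x m) using 1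
    push_cast
    ring_nf
  convert! (HasDerivAt.fun_sum h).const_sub 1 using 1

theorem hasDerivAt_cosPartialDeriv (x : ℝ) (N : ℕ) (θ : ℝ) :
    HasDerivAt (cosPartialDeriv x N)
      (cosCoeff x N * ((2 * N + 2) * (2 * N + 1)) * Real.sin θ ^ (2 * N) -
        4 * x ^ 2 * cosPartial x N θ) θ := by
  induction N with
  | zero =>
    have : cosPartialDeriv x 0 = fun _ => 0 := by
      ext
      simp [cosPartialDeriv]
    rw [this]
    convert! hasDerivAt_const θ (0 : ℝ) using 1
    simp [cosPartial, cosCoeff]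
    ring
  | succ N ih =>
    have hfun : cosPartialDeriv x (N + 1) = fun θ => cosPartialDeriv x N θ -
        cosCoeff x N * ((2 * N + 2) * (Real.sin θ ^ (2 * N + 1) * Real.cos θ)) := by
      ext
      simp only [cosPartialDeriv, Finset.sum_range_succ]
      ring
    rw [hfun]
    have hs := (((Real.hasDerivAt_sin θ).pow (2 * N + 1)).mul (Real.hasDerivAt_cos θ)).const_mul
      ((2 * N + 2 : ℝ))
    convert! ih.sub (hs.const_mul (cosCoeff x N)) using 1
    have hN : (2 * (N : ℝ) + 4) * (2 * N + 3) ≠ 0 := by positivity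
    have hc : cosCoeff x (N + 1) * ((2 * ((N + 1 : ℕ) : ℝ) + 2) * (2 * ((N + 1 : ℕ) : ℝ) + 1)) =
        cosCoeff x N * (4 * ((N : ℝ) + 1) ^ 2 - 4 * x ^ 2) := by
      rw [cosCoeff]
      push_cast
      rw [show (2 * ((N : ℝ) + 1) + 2) * (2 * (N + 1) + 1) = (2 * N + 4) * (2 * N + 3) by ring,
        div_mul_cancel₀ _ hN]
    have hp : cosPartial x (N + 1) θ =
        cosPartial x N θ - cosCoeff x N * Real.sin θ ^ (2 * N + 2) := by
      simp only [cosPartial, Finset.sum_range_succ]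
      ring
    have hcos : Real.cos θ * Real.cos θ = 1 - Real.sin θ ^ 2 := by
      rw [← sq, Real.cos_sq']
    rw [hc, hp]
    simp only [Pi.pow_apply, Nat.add_sub_cancel]
    push_cast
    rw [show ((2 * (N : ℝ) + 1) * Real.sin θ ^ (2 * N) * Real.cos θ * Real.cos θ +
      Real.sin θ ^ (2 * N + 1) * -Real.sin θ) = (2 * (N : ℝ) + 1) * Real.sin θ ^ (2 * N) *
      (Real.cos θ * Real.cos θ) - Real.sin θ ^ (2 * N + 2) by ring, hcos]
    ring

theorem cosPartial_sub_cos_eq {x t : ℝ} (N : ℕ) (ht : 0 < t) :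
    ∃ c ∈ Set.Ioo 0 t, 2 * x * (cosPartial x N t - Real.cos (2 * x * t)) =
      cosCoeff x N * ((2 * N + 2) * (2 * N + 1)) * Real.sin c ^ (2 * N) *
        Real.sin (2 * x * (t - c)) * t := by
  set W : ℝ → ℝ := fun θ =>
    (cosPartialDeriv x N θ + 2 * x * Real.sin (2 * x * θ)) * Real.sin (2 * x * (t - θ)) +
      2 * x * ((cosPartial x N θ - Real.cos (2 * x * θ)) * Real.cos (2 * x * (t - θ))) with hW
  have hd : ∀ θ, HasDerivAt W (cosCoeff x N * ((2 * N + 2) * (2 * N + 1)) *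
      Real.sin θ ^ (2 * N) * Real.sin (2 * x * (t - θ))) θ := by
    intro θ
    have h1 : HasDerivAt (fun θ : ℝ => 2 * x * θ) (2 * x) θ := by
      simpa using (hasDerivAt_id θ).const_mul (2 * x)
    have h2 : HasDerivAt (fun θ : ℝ => 2 * x * (t - θ)) (-(2 * x)) θ := by
      simpa using ((hasDerivAt_id θ).const_sub t).const_mul (2 * x)
    have := (((hasDerivAt_cosPartialDeriv x N θ).add (h1.sin.const_mul (2 * x))).mul h2.sin).add
      ((((hasDerivAt_cosPartial x N θ).sub h1.cos).mul h2.cos).const_mul (2 * x))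
    convert! this using 1
    simp only [Pi.add_apply, Pi.sub_apply]
    ring
  obtain ⟨c, hc, hcW⟩ := exists_hasDerivAt_eq_slope W _ ht
    (fun θ _ => (hd θ).continuousAt.continuousWithinAt) (fun θ _ => hd θ)
  refine ⟨c, hc, ?_⟩
  rw [hcW, sub_zero, div_mul_cancel₀ _ ht.ne']
  simp only [hW, cosPartialDeriv, cosPartial]
  simp

theorem cos_le_cosPartial {x t : ℝ} (hx : 0 < x) (hx' : x ≤ 1 / 2) (ht : 0 ≤ t)
    (ht' : t ≤ Real.pi / 2) (N : ℕ) : Real.cos (2 * x * t) ≤ cosPartial x N t := by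
  rcases ht.eq_or_lt with rfl | ht
  · simp [cosPartial]
  obtain ⟨c, hc, h⟩ := cosPartial_sub_cos_eq (x := x) N ht
  have hcN := cosCoeff_nonneg (x := x) (by nlinarith) N
  have h1 : 0 ≤ Real.sin c :=
    Real.sin_nonneg_of_nonneg_of_le_pi hc.1.le (by linarith [hc.2, Real.pi_pos])
  have h2 : 0 ≤ Real.sin (2 * x * (t - c)) := by
    refine Real.sin_nonneg_of_nonneg_of_le_pi (mul_nonneg (by linarith) (by linarith [hc.2])) ?_
    nlinarith [hc.1, hc.2, Real.pi_pos]
  have h3 : 0 ≤ 2 * x * (cosPartial x N t - Real.cos (2 * x * t)) := by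
    rw [h]
    positivity
  have := nonneg_of_mul_nonneg_right h3 (by linarith)
  linarith

theorem tendsto_cosPartial {x t : ℝ} (hx : 0 < x) (hx' : x ≤ 1 / 2) (ht : 0 < t)
    (ht' : t < Real.pi / 2) :
    Tendsto (fun N => cosPartial x N t) atTop (𝓝 (Real.cos (2 * x * t))) := by
  have hs0 : 0 < Real.sin t := Real.sin_pos_of_pos_of_lt_pi ht (by linarith)
  have hs1 : Real.sin t < 1 := by
    rw [← Real.sin_pi_div_two]
    exact Real.strictMonoOn_sin ⟨by linarith, ht'.le⟩ ⟨by linarith, le_rfl⟩ ht'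
  have hq : Real.sin t ^ 2 < 1 := by nlinarith
  have hlim : Tendsto (fun N : ℕ => 2 * x * t * (2 * ((N : ℝ) * (Real.sin t ^ 2) ^ N) +
      (Real.sin t ^ 2) ^ N)) atTop (𝓝 (2 * x * t * (2 * 0 + 0))) :=
    (((tendsto_self_mul_const_pow_of_lt_one (by positivity) hq).const_mul 2).add
      (tendsto_pow_atTop_nhds_zero_of_lt_one (by positivity) hq)).const_mul _
  rw [tendsto_iff_dist_tendsto_zero]
  refine squeeze_zero (fun _ => dist_nonneg) (fun N => ?_) (by simpa using hlim)
  rw [Real.dist_eq, abs_of_nonneg (by linarith [cos_le_cosPartial hx hx' ht.le ht'.le N])]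
  obtain ⟨c, hc, h⟩ := cosPartial_sub_cos_eq (x := x) N ht
  have hx2 : x ^ 2 ≤ 1 := by nlinarith
  have hcN := cosCoeff_nonneg hx2 N
  have h1 : 0 ≤ Real.sin c :=
    Real.sin_nonneg_of_nonneg_of_le_pi hc.1.le (by linarith [hc.2, Real.pi_pos])
  have h1' : Real.sin c ≤ Real.sin t :=
    Real.strictMonoOn_sin.monotoneOn ⟨by linarith [hc.1], by linarith [hc.2]⟩
      ⟨by linarith, ht'.le⟩ hc.2.le
  have hle : 2 * x * (cosPartial x N t - Real.cos (2 * x * t)) ≤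
      2 * x * (2 * x * t * (2 * ((N : ℝ) * (Real.sin t ^ 2) ^ N) + (Real.sin t ^ 2) ^ N)) := by
    rw [h]
    calc _ ≤ cosCoeff x N * ((2 * N + 2) * (2 * N + 1)) * Real.sin t ^ (2 * N) * 1 * t := by
          have h2 : 0 ≤ Real.sin (2 * x * (t - c)) := by
            refine Real.sin_nonneg_of_nonneg_of_le_pi
              (mul_nonneg (by linarith) (by linarith [hc.2])) ?_
            nlinarith [hc.1, hc.2, Real.pi_pos]
          gcongr
          exact Real.sin_le_one _
      _ = (cosCoeff x N * (N + 1)) * (2 * (2 * N + 1) * Real.sin t ^ (2 * N) * t) := by ring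
      _ ≤ (2 * x ^ 2) * (2 * (2 * N + 1) * Real.sin t ^ (2 * N) * t) := by
          exact mul_le_mul_of_nonneg_right (cosCoeff_mul_le hx2 N) (by positivity)
      _ = _ := by
          rw [pow_mul]
          ring
  exact le_of_mul_le_mul_left hle (by linarith)

theorem one_sub_cos_le_two_mul_sin {x v : ℝ} (hx : 0 < x) (hx' : x ≤ 1 / 2) (hv : 0 ≤ v)
    (hv' : v ≤ Real.pi / 2) : 1 - Real.cos (2 * x * v) ≤ 2 * Real.sin v := by
  have h1 := Real.one_sub_sq_div_two_le_cos (x := 2 * x * v)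
  have h2 := Real.mul_le_sin hv hv'
  have h3 : (2 * x * v) ^ 2 ≤ v ^ 2 :=
    pow_le_pow_left₀ (by positivity) (mul_le_of_le_one_left hv (by linarith)) 2
  have h4 : 1 / 2 ≤ 2 / Real.pi := by
    rw [div_le_div_iff₀ (by norm_num) Real.pi_pos]
    linarith [Real.pi_le_four]
  have h5 : 1 / 2 * v ≤ 2 / Real.pi * v := by gcongr
  nlinarith [Real.pi_le_four]

/-- The integral `∫_0^{π/2} cos (2yφ) cos φ ^ n dφ`. -/
noncomputable def cosPowIntegral (y : ℝ) (n : ℕ) : ℝ :=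
  ∫ φ in (0 : ℝ)..Real.pi / 2, Real.cos (2 * y * φ) * Real.cos φ ^ n

theorem ofReal_cosPowIntegral (y : ℝ) (n : ℕ) : (cosPowIntegral y n : ℂ) =
    ∫ φ in (0 : ℝ)..Real.pi / 2, Complex.cos (2 * y * φ) * (Real.cos φ : ℂ) ^ n := by
  rw [cosPowIntegral, ← intervalIntegral.integral_ofReal]
  push_cast
  rfl

theorem cosPowIntegral_add_two {y : ℝ} (hy : y ≠ 0) (n : ℕ) :
    (1 - 4 * y ^ 2 / ((n : ℝ) + 2) ^ 2) * cosPowIntegral y (n + 2) =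
      ((n : ℝ) + 1) / (n + 2) * cosPowIntegral y n := by
  have h := EulerSine.integral_cos_mul_cos_pow (n := n + 2) (z := y) (by omega)
    (by exact_mod_cast hy)
  rw [Nat.add_sub_cancel, ← ofReal_cosPowIntegral, ← ofReal_cosPowIntegral] at h
  push_cast at h
  rw [show ((n : ℂ) + 2 - 1) = n + 1 by ring] at h
  apply Complex.ofReal_injective
  push_cast
  exact h

theorem integral_sin_mul_sin_mul_cos_pow {y : ℝ} (hy : y ≠ 0) (m : ℕ) :
    ∫ φ in (0 : ℝ)..Real.pi / 2, Real.sin (2 * y * φ) * Real.sin φ * Real.cos φ ^ (2 * m + 1) =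
      y / (m + 1) * cosPowIntegral y (2 * m + 2) := by
  have h := EulerSine.integral_cos_mul_cos_pow_aux (n := 2 * m + 2) (z := y) (by omega)
    (by exact_mod_cast hy)
  rw [← ofReal_cosPowIntegral, show 2 * m + 2 - 1 = 2 * m + 1 by omega] at h
  have h' : cosPowIntegral y (2 * m + 2) = ((2 * m + 2 : ℕ) : ℝ) / (2 * y) *
      ∫ φ in (0 : ℝ)..Real.pi / 2,
        Real.sin (2 * y * φ) * Real.sin φ * Real.cos φ ^ (2 * m + 1) := by
    apply Complex.ofReal_injective
    rw [h, Complex.ofReal_mul, ← intervalIntegral.integral_ofReal]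
    push_cast
    rfl
  rw [h']
  push_cast
  field_simp

theorem cosPowIntegral_zero {y : ℝ} (hy : y ≠ 0) :
    cosPowIntegral y 0 = Real.sin (Real.pi * y) / (2 * y) := by
  simp only [cosPowIntegral, pow_zero, mul_one]
  rw [intervalIntegral.integral_comp_mul_left (fun u => Real.cos u) (by simpa using hy),
    integral_cos]
  simp
  rw [show 2 * y * (Real.pi / 2) = Real.pi * y by ring]
  field_simp

theorem cosCoeff_mul_cosPowIntegral {x y : ℝ} (hy : 2 * y ^ 2 < 1) (hy0 : y ≠ 0) (m : ℕ) :
    cosCoeff x m * cosPowIntegral y (2 * m + 2) =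
      Real.pi / 2 * x ^ 2 * (∏ j ∈ Finset.range m, (1 - x ^ 2 / ((j : ℝ) + 1) ^ 2)) *
        (twosGen y (m + 1) / ((m : ℝ) + 1) ^ 2) := by
  have hne : ∀ k : ℕ, 1 - y ^ 2 / ((k : ℝ) + 1) ^ 2 ≠ 0 := by
    intro k
    have hk : (0 : ℝ) ≤ k := Nat.cast_nonneg k
    have : y ^ 2 / ((k : ℝ) + 1) ^ 2 < 1 := by
      rw [div_lt_one (by positivity)]
      nlinarith
    linarith
  induction m with
  | zero =>
    have h1 := cosPowIntegral_add_two hy0 0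
    rw [cosPowIntegral_zero hy0, ← pi_mul_twosGen_zero hy, twosGen_eq_mul hy] at h1
    have h2 := hne 0
    simp only [Nat.cast_zero, zero_add, one_pow, div_one] at h1 h2 ⊢
    simp only [cosCoeff, mul_zero, zero_add, Finset.range_zero, Finset.prod_empty, mul_one]
    have h3 : cosPowIntegral y 2 = Real.pi / 4 * twosGen y 1 := by
      refine mul_left_cancel₀ h2 ?_
      rw [show 1 - y ^ 2 = 1 - 4 * y ^ 2 / 2 ^ 2 by ring, h1]
      field_simp
      ring
    rw [h3]
    ring
  | succ m ih =>
    have h1 := cosPowIntegral_add_two hy0 (2 * m + 2)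
    have h2 := hne (m + 1)
    have h4 := twosGen_eq_mul hy (m + 1)
    have hm : (0 : ℝ) ≤ m := Nat.cast_nonneg m
    rw [show 2 * (m + 1) + 2 = 2 * m + 2 + 2 by ring]
    push_cast at h1 h2 h4 ⊢
    rw [show 1 - 4 * y ^ 2 / (2 * (m : ℝ) + 2 + 2) ^ 2 = 1 - y ^ 2 / ((m : ℝ) + 1 + 1) ^ 2 by
      field_simp
      ring] at h1
    refine mul_left_cancel₀ h2 ?_
    rw [Finset.prod_range_succ, cosCoeff]
    calc _ = cosCoeff x m * (4 * ((m : ℝ) + 1) ^ 2 - 4 * x ^ 2) / ((2 * m + 4) * (2 * m + 3)) *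
          ((1 - y ^ 2 / ((m : ℝ) + 1 + 1) ^ 2) * cosPowIntegral y (2 * m + 2 + 2)) := by ring
      _ = (cosCoeff x m * cosPowIntegral y (2 * m + 2)) *
          ((4 * ((m : ℝ) + 1) ^ 2 - 4 * x ^ 2) / ((2 * m + 4) * (2 * m + 3)) *
            ((2 * m + 2 + 1) / (2 * m + 2 + 2))) := by
          rw [h1]
          ring
      _ = _ := by
          rw [ih, h4]
          field_simp
          ring

theorem intervalIntegrable_sin_mul_sin_mul_cos_pow (y : ℝ) (m : ℕ) :
    IntervalIntegrable (fun φ => Real.sin (2 * y * φ) * Real.sin φ * Real.cos φ ^ (2 * m + 1))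
      volume 0 (Real.pi / 2) :=
  Continuous.intervalIntegrable (by fun_prop) _ _

theorem integral_sin_mul_tan_mul_one_sub_cosPartial {x y : ℝ} (hy : 2 * y ^ 2 < 1) (hy0 : y ≠ 0)
    (N : ℕ) :
    ∫ φ in (0 : ℝ)..Real.pi / 2, Real.sin (2 * y * φ) * (Real.sin φ / Real.cos φ) *
      (1 - cosPartial x N (Real.pi / 2 - φ)) =
      Real.pi / 2 * x ^ 2 * y * ∑ m ∈ Finset.range N,
        (∏ j ∈ Finset.range m, (1 - x ^ 2 / ((j : ℝ) + 1) ^ 2)) *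
          (twosGen y (m + 1) / ((m : ℝ) + 1) ^ 3) := by
  have hfun : ∀ φ, Real.sin (2 * y * φ) * (Real.sin φ / Real.cos φ) *
      (1 - cosPartial x N (Real.pi / 2 - φ)) = ∑ m ∈ Finset.range N, cosCoeff x m *
        (Real.sin (2 * y * φ) * Real.sin φ * Real.cos φ ^ (2 * m + 1)) := by
    intro φ
    simp only [cosPartial, Real.sin_pi_div_two_sub, sub_sub_cancel, Finset.mul_sum]
    refine Finset.sum_congr rfl fun m _ => ?_
    by_cases h : Real.cos φ = 0
    · simp [h]
    · field_simp
      ring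
  simp_rw [hfun]
  rw [intervalIntegral.integral_finsetSum fun m _ =>
    (intervalIntegrable_sin_mul_sin_mul_cos_pow y m).const_mul _, Finset.mul_sum]
  refine Finset.sum_congr rfl fun m _ => ?_
  have h := cosCoeff_mul_cosPowIntegral (x := x) hy hy0 m
  rw [intervalIntegral.integral_const_mul, integral_sin_mul_sin_mul_cos_pow hy0,
    mul_left_comm, h]
  field_simp

theorem tendsto_integral_sin_mul_tan {x y : ℝ} (hx : 0 < x) (hx' : x ≤ 1 / 2) :
    Tendsto (fun N => ∫ φ in (0 : ℝ)..Real.pi / 2, Real.sin (2 * y * φ) *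
      (Real.sin φ / Real.cos φ) * (1 - cosPartial x N (Real.pi / 2 - φ))) atTop
      (𝓝 (∫ φ in (0 : ℝ)..Real.pi / 2, Real.sin (2 * y * φ) *
      (Real.sin φ / Real.cos φ) * (1 - Real.cos (2 * x * (Real.pi / 2 - φ))))) := by
  have hpi := Real.pi_pos
  refine intervalIntegral.tendsto_integral_filter_of_dominated_convergence (fun _ => 2)
    (Eventually.of_forall fun N => ?_) (Eventually.of_forall fun N => ?_)
    intervalIntegrable_const ?_
  · have : Measurable (cosPartial x N) := by
      unfold cosPartial
      fun_prop
    exact Measurable.aestronglyMeasurable (by fun_prop)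
  · refine Eventually.of_forall fun φ hφ => ?_
    rw [Set.uIoc_of_le (by positivity)] at hφ
    have hv : 0 ≤ Real.pi / 2 - φ := by linarith [hφ.2]
    have hv' : Real.pi / 2 - φ ≤ Real.pi / 2 := by linarith [hφ.1]
    have h1 := cos_le_cosPartial hx hx' hv hv' N
    have h2 := one_sub_cos_le_two_mul_sin hx hx' hv hv'
    rw [Real.sin_pi_div_two_sub] at h2
    have h3 : 0 ≤ 1 - cosPartial x N (Real.pi / 2 - φ) := by
      simp only [cosPartial, sub_sub_cancel, Real.sin_pi_div_two_sub]
      refine Finset.sum_nonneg fun m _ => mul_nonneg (cosCoeff_nonneg (by nlinarith) m) ?_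
      rw [show 2 * m + 2 = 2 * (m + 1) by ring, pow_mul]
      positivity
    have hc : 0 ≤ Real.cos φ := Real.cos_nonneg_of_mem_Icc ⟨by linarith [hφ.1], hφ.2⟩
    rcases hc.eq_or_lt with hc | hc
    · simp [← hc]
    rw [norm_mul, norm_mul, norm_div, Real.norm_of_nonneg hc.le, Real.norm_of_nonneg h3,
      Real.norm_eq_abs, Real.norm_eq_abs]
    calc _ ≤ 1 * (1 / Real.cos φ) * (2 * Real.cos φ) := by
          gcongr
          · exact Real.abs_sin_le_one _
          · exact Real.abs_sin_le_one _
          · linarith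
      _ = 2 := by field_simp
  · have hne : ∀ᵐ φ : ℝ, φ ≠ Real.pi / 2 := by
      simp [ae_iff, measure_singleton]
    filter_upwards [hne] with φ hφne hφ
    rw [Set.uIoc_of_le (by positivity)] at hφ
    have hlt : φ < Real.pi / 2 := lt_of_le_of_ne hφ.2 hφne
    exact ((tendsto_cosPartial hx hx' (by linarith) (by linarith [hφ.1])).const_sub 1).const_mul _

theorem integral_eq_hGen {x y : ℝ} (hx : 0 < x) (hx' : x ≤ 1 / 2) (hy : 2 * y ^ 2 < 1)
    (hy0 : y ≠ 0) :
    ∫ v in (0 : ℝ)..Real.pi / 2, Real.sin (Real.pi * y - 2 * y * v) *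
      (1 - Real.cos (2 * x * v)) / Real.sin v * Real.cos v =
      Real.pi / 2 * x ^ 2 * y * hGen x y 0 := by
  have hx2 : 2 * x ^ 2 < 1 := by nlinarith
  have h1 := tendsto_integral_sin_mul_tan (y := y) hx hx'
  simp_rw [integral_sin_mul_tan_mul_one_sub_cosPartial (x := x) hy hy0] at h1
  have h2 := (tendsto_sum_hGen hx2 hy).const_mul (Real.pi / 2 * x ^ 2 * y)
  rw [← tendsto_nhds_unique h1 h2]
  have := intervalIntegral.integral_comp_sub_left (a := 0) (b := Real.pi / 2)
    (fun φ => Real.sin (2 * y * φ) * (Real.sin φ / Real.cos φ) *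
      (1 - Real.cos (2 * x * (Real.pi / 2 - φ)))) (Real.pi / 2)
  rw [sub_self, sub_zero] at this
  rw [← this]
  refine intervalIntegral.integral_congr fun v _ => ?_
  simp only [Real.sin_pi_div_two_sub, Real.cos_pi_div_two_sub, sub_sub_cancel]
  rw [show 2 * y * (Real.pi / 2 - v) = Real.pi * y - 2 * y * v by ring]
  ring

theorem tendsto_integral_mul_cos_odd {g : ℝ → ℝ} {b : ℝ} (hb : 0 ≤ b)
    (hg : IntervalIntegrable g volume 0 b) :
    Tendsto (fun N : ℕ => ∫ v in (0 : ℝ)..b, g v * Real.cos ((2 * N + 1) * v)) atTop (𝓝 0) := by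
  have hlim : Tendsto (fun N : ℕ => (2 * (N : ℝ) + 1) / (2 * Real.pi)) atTop (cocompact ℝ) := by
    refine Tendsto.mono_right ?_ atTop_le_cocompact
    refine Tendsto.atTop_div_const (by positivity) (tendsto_atTop_add_const_right _ _ ?_)
    exact tendsto_natCast_atTop_atTop.const_mul_atTop (by norm_num)
  have h := (Real.tendsto_integral_exp_smul_cocompact
    ((Set.Ioc 0 b).indicator fun v => (g v : ℂ))).comp hlim
  have h' := (Complex.continuous_re.tendsto 0).comp h
  rw [Complex.zero_re] at h'
  refine h'.congr fun N => ?_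
  have hpt : ∀ v : ℝ, (Real.fourierChar (-(v * ((2 * (N : ℝ) + 1) / (2 * Real.pi)))) : Circle) •
      (Set.Ioc 0 b).indicator (fun v => (g v : ℂ)) v =
      (Set.Ioc 0 b).indicator (fun v => (g v : ℂ) *
        Complex.exp (((-((2 * (N : ℝ) + 1) * v) : ℝ) : ℂ) * Complex.I)) v := by
    intro v
    by_cases hv : v ∈ Set.Ioc 0 b
    · rw [Set.indicator_of_mem hv, Set.indicator_of_mem hv, Circle.smul_def, Real.fourierChar_apply,
        smul_eq_mul, mul_comm]
      congr 4
      have := Real.pi_ne_zero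
      field_simp
    · simp [Set.indicator_of_notMem hv]
  simp only [Function.comp_apply]
  simp_rw [hpt]
  rw [integral_indicator measurableSet_Ioc, intervalIntegral.integral_of_le hb]
  have hInt : Integrable (fun v => (g v : ℂ) *
      Complex.exp (((-((2 * (N : ℝ) + 1) * v) : ℝ) : ℂ) * Complex.I))
      (volume.restrict (Set.Ioc 0 b)) := by
    have hg' : Integrable (fun v => (g v : ℂ)) (volume.restrict (Set.Ioc 0 b)) :=
      ((intervalIntegrable_iff_integrableOn_Ioc_of_le hb).mp hg).ofReal
    refine hg'.mul_bdd (c := 1) (Continuous.aestronglyMeasurable (by fun_prop)) ?_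
    exact Eventually.of_forall fun v => by rw [Complex.norm_exp_ofReal_mul_I]
  have hre := integral_re hInt
  simp only [RCLike.re_to_complex] at hre
  rw [← hre]
  refine integral_congr_ae (Eventually.of_forall fun v => ?_)
  simp only [Complex.re_ofReal_mul, Complex.exp_ofReal_mul_I_re, Real.cos_neg]

theorem two_mul_sum_sin_mul_sin (v : ℝ) (N : ℕ) :
    2 * (∑ n ∈ Finset.range N, Real.sin (2 * (n + 1) * v)) * Real.sin v =
      Real.cos v - Real.cos ((2 * N + 1) * v) := by
  induction N with
  | zero => simp
  | succ N ih =>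
    rw [Finset.sum_range_succ, mul_add, add_mul, ih]
    have h1 : (2 * (N : ℝ) + 1) * v = 2 * (N + 1) * v - v := by ring
    have h2 : (2 * ((N + 1 : ℕ) : ℝ) + 1) * v = 2 * (N + 1) * v + v := by push_cast; ring
    rw [h1, h2, Real.cos_sub, Real.cos_add]
    ring

theorem integral_sin_sub_mul_sin (α w : ℝ) (n : ℕ) (h₁ : (n : ℝ) + w ≠ 0) (h₂ : (n : ℝ) - w ≠ 0) :
    ∫ v in (0 : ℝ)..Real.pi / 2, Real.sin (α - 2 * w * v) * Real.sin (2 * n * v) =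
      (Real.sin α - (-1) ^ n * Real.sin (α - Real.pi * w)) / 2 * (n / (n ^ 2 - w ^ 2)) := by
  have hd : ∀ v, HasDerivAt (fun v => -Real.sin (α - 2 * (n + w) * v) / (4 * (n + w)) -
      Real.sin (α + 2 * (n - w) * v) / (4 * (n - w)))
      (Real.sin (α - 2 * w * v) * Real.sin (2 * n * v)) v := by
    intro v
    have e1 : HasDerivAt (fun v : ℝ => α - 2 * (n + w) * v) (-(2 * (n + w))) v := by
      simpa using ((hasDerivAt_id v).const_mul (2 * (n + w))).const_sub α
    have e2 : HasDerivAt (fun v : ℝ => α + 2 * (n - w) * v) (2 * (n - w)) v := by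
      simpa using ((hasDerivAt_id v).const_mul (2 * (n - w))).const_add α
    convert! ((e1.sin.fun_neg).div_const (4 * (n + w))).sub (e2.sin.div_const (4 * (n - w))) using 1
    rw [show α - 2 * (n + w) * v = (α - 2 * w * v) - 2 * n * v by ring,
      show α + 2 * (n - w) * v = (α - 2 * w * v) + 2 * n * v by ring, Real.cos_sub, Real.cos_add]
    field_simp
    ring
  rw [intervalIntegral.integral_eq_sub_of_hasDerivAt (fun v _ => hd v)
    (Continuous.intervalIntegrable (by fun_prop) _ _)]
  have s1 : Real.sin (α - 2 * (n + w) * (Real.pi / 2)) =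
      (-1) ^ n * Real.sin (α - Real.pi * w) := by
    rw [show α - 2 * (n + w) * (Real.pi / 2) = (α - Real.pi * w) - n * Real.pi by ring,
      Real.sin_sub_nat_mul_pi]
  have s2 : Real.sin (α + 2 * (n - w) * (Real.pi / 2)) =
      (-1) ^ n * Real.sin (α - Real.pi * w) := by
    rw [show α + 2 * (n - w) * (Real.pi / 2) = (α - Real.pi * w) + n * Real.pi by ring,
      Real.sin_add_nat_mul_pi]
  rw [s1, s2]
  simp only [mul_zero, sub_zero, add_zero]
  rw [show (n : ℝ) ^ 2 - w ^ 2 = (n + w) * (n - w) by ring]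
  field_simp
  ring

/-- The `n`-th term of `∑_{n ≥ 1} (n / (n² - z²) - 1 / n)`, with indices shifted to start at `0`. -/
noncomputable def poleTerm (z : ℝ) (n : ℕ) : ℝ :=
  z ^ 2 / (((n : ℝ) + 1) * (((n : ℝ) + 1) ^ 2 - z ^ 2))

/-- The sum `∑_{n ≥ 1} (n / (n² - z²) - 1 / n) = ∑_{r ≥ 1} ζ(2r+1) z^(2r)`. -/
noncomputable def poleSum (z : ℝ) : ℝ := ∑' n, poleTerm z n

theorem summable_pow_div_pow {z : ℝ} (hz : |z| < 1) :
    Summable fun p : ℕ × ℕ => z ^ (2 * p.1 + 2) / ((p.2 : ℝ) + 1) ^ (2 * p.1 + 3) := by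
  have hz2 : z ^ 2 < 1 := (sq_lt_one_iff_abs_lt_one z).mpr hz
  have h1 : Summable fun s : ℕ => (z ^ 2) ^ s * z ^ 2 :=
    (summable_geometric_of_lt_one (by positivity) hz2).mul_right _
  have h2 : Summable fun n : ℕ => 1 / ((n : ℝ) + 1) ^ 3 := by
    exact_mod_cast (summable_nat_add_iff 1).mpr
      (Real.summable_one_div_nat_pow.mpr (by norm_num : 1 < 3))
  refine .of_nonneg_of_le (fun p => ?_) (fun p => ?_)
    (h1.mul_of_nonneg h2 (fun s => by positivity) (fun n => by positivity))
  · have : 0 ≤ z ^ (2 * p.1 + 2) := by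
      rw [show 2 * p.1 + 2 = 2 * (p.1 + 1) by ring, pow_mul]
      positivity
    positivity
  · rw [show z ^ (2 * p.1 + 2) = (z ^ 2) ^ p.1 * z ^ 2 by ring, div_eq_mul_one_div]
    gcongr
    · linarith [Nat.cast_nonneg (α := ℝ) p.2]
    · omega

theorem hasSum_geometric_poleTerm {z : ℝ} (hz : |z| < 1) (n : ℕ) :
    HasSum (fun s : ℕ => z ^ (2 * s + 2) / ((n : ℝ) + 1) ^ (2 * s + 3)) (poleTerm z n) := by
  have hz2 : z ^ 2 < 1 := (sq_lt_one_iff_abs_lt_one z).mpr hz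
  have hn : (0 : ℝ) ≤ n := Nat.cast_nonneg n
  have hlt : z ^ 2 < ((n : ℝ) + 1) ^ 2 := by nlinarith
  have hq : z ^ 2 / ((n : ℝ) + 1) ^ 2 < 1 := by
    rw [div_lt_one (by positivity)]
    exact hlt
  have h := (hasSum_geometric_of_lt_one (by positivity) hq).mul_right
    (z ^ 2 / ((n : ℝ) + 1) ^ 3)
  have hne : ((n : ℝ) + 1) ^ 2 - z ^ 2 ≠ 0 := by linarith
  convert! h using 1
  · ext s
    rw [div_pow, ← pow_mul, ← pow_mul, pow_add, pow_add, mul_div_mul_comm]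
  · rw [poleTerm, one_sub_div (by positivity)]
    field_simp

theorem riemannZetaReal_eq (k : ℕ) : riemannZetaReal k = ∑' n : ℕ, 1 / ((n : ℝ) + 1) ^ k := by
  rw [riemannZetaReal]
  have := tsum_pnat_eq_tsum_succ (f := fun n : ℕ => (1 : ℝ) / (n : ℝ) ^ k)
  rw [this]
  push_cast
  rfl

theorem hasSum_poleTerm {z : ℝ} (hz : |z| < 1) : HasSum (poleTerm z) (poleSum z) := by
  have h := ((Equiv.prodComm ℕ ℕ).hasSum_iff.mpr (summable_pow_div_pow hz).hasSum).prod_fiberwise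
    (fun n => hasSum_geometric_poleTerm hz n)
  exact h.summable.hasSum

theorem hasSum_zeta_mul_pow {z : ℝ} (hz : |z| < 1) :
    HasSum (fun s : ℕ => riemannZetaReal (2 * (s + 1) + 1) * z ^ (2 * (s + 1))) (poleSum z) := by
  have hs := (summable_pow_div_pow hz).hasSum
  have h := ((Equiv.prodComm ℕ ℕ).hasSum_iff.mpr hs).prod_fiberwise
    (fun n => hasSum_geometric_poleTerm hz n)
  rw [poleSum, h.tsum_eq]
  convert! (hs.prod_fiberwise fun s => (hs.summable.prod_factor s).hasSum) using 1
  ext s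
  rw [riemannZetaReal_eq, mul_comm, ← tsum_mul_left]
  refine tsum_congr fun n => ?_
  rw [mul_one_div]
  rfl

/-- The sum `∑_{n ≥ 1} (-1)^(n-1) (n / (n² - z²) - 1 / n)`. -/
noncomputable def altPoleSum (z : ℝ) : ℝ := poleSum z - poleSum (z / 2)

theorem abs_half_lt_one {z : ℝ} (hz : |z| < 1) : |z / 2| < 1 := by
  rw [abs_div, abs_two]
  linarith [abs_nonneg z]

theorem hasSum_alt_poleTerm {z : ℝ} (hz : |z| < 1) :
    HasSum (fun n => (-1) ^ n * poleTerm z n) (altPoleSum z) := by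
  have hA := hasSum_poleTerm hz
  have hodd : HasSum (fun k => poleTerm z (2 * k + 1)) (poleSum (z / 2) / 2) := by
    convert! (hasSum_poleTerm (abs_half_lt_one hz)).div_const 2 using 1
    ext k
    have hk : (0 : ℝ) ≤ k := Nat.cast_nonneg k
    have hz2 : z ^ 2 < 1 := (sq_lt_one_iff_abs_lt_one z).mpr hz
    have h1 : (2 * (k : ℝ) + 1 + 1) ^ 2 - z ^ 2 ≠ 0 := by nlinarith
    have h2 : ((k : ℝ) + 1) ^ 2 - (z / 2) ^ 2 ≠ 0 := by nlinarith
    simp only [poleTerm]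
    push_cast
    rw [div_div, div_eq_div_iff (mul_ne_zero (by positivity) h1)
      (mul_ne_zero (mul_ne_zero (by positivity) h2) two_ne_zero)]
    ring
  have heven : HasSum (fun k => poleTerm z (2 * k)) (∑' k, poleTerm z (2 * k)) :=
    (hA.summable.comp_injective (i := fun k : ℕ => 2 * k)
      (mul_right_injective₀ two_ne_zero)).hasSum
  have hsum := (heven.even_add_odd hodd).unique hA
  have hval : altPoleSum z = ∑' k, poleTerm z (2 * k) + -(poleSum (z / 2) / 2) := by
    rw [altPoleSum]
    linarith
  rw [hval]
  refine HasSum.even_add_odd (heven.congr_fun fun k => ?_) (hodd.neg.congr_fun fun k => ?_)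
  · rw [(even_two_mul k).neg_one_pow, one_mul]
  · rw [(odd_two_mul_add_one k).neg_one_pow, neg_one_mul]

theorem hasSum_alt_zeta_mul_pow {z : ℝ} (hz : |z| < 1) :
    HasSum (fun s : ℕ => (1 - 1 / 2 ^ (2 * (s + 1))) * riemannZetaReal (2 * (s + 1) + 1) *
      z ^ (2 * (s + 1))) (altPoleSum z) := by
  convert! (hasSum_zeta_mul_pow hz).sub (hasSum_zeta_mul_pow (abs_half_lt_one hz)) using 1
  ext s
  rw [div_pow]
  ring

theorem natCast_div_sq_sub_sq {z : ℝ} (hz : |z| < 1) (n : ℕ) :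
    ((n : ℝ) + 1) / (((n : ℝ) + 1) ^ 2 - z ^ 2) = 1 / ((n : ℝ) + 1) + poleTerm z n := by
  have hz2 : z ^ 2 < 1 := (sq_lt_one_iff_abs_lt_one z).mpr hz
  have hn : (0 : ℝ) ≤ n := Nat.cast_nonneg n
  have h1 : ((n : ℝ) + 1) ^ 2 - z ^ 2 ≠ 0 := by nlinarith
  rw [poleTerm]
  field_simp
  ring

theorem integral_sin_sub_mul_sin_succ (α : ℝ) {w : ℝ} (hw : |w| < 1) (n : ℕ) :
    ∫ v in (0 : ℝ)..Real.pi / 2, Real.sin (α - 2 * w * v) * Real.sin (2 * (n + 1) * v) =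
      (Real.sin α + (-1) ^ n * Real.sin (α - Real.pi * w)) / 2 *
        (1 / ((n : ℝ) + 1) + poleTerm w n) := by
  have hn : (0 : ℝ) ≤ n := Nat.cast_nonneg n
  obtain ⟨h₁, h₂⟩ := abs_lt.mp hw
  have h := integral_sin_sub_mul_sin α w (n + 1) (by push_cast; linarith) (by push_cast; linarith)
  push_cast at h
  rw [h, natCast_div_sq_sub_sq hw, pow_succ]
  ring

theorem two_mul_integral_mul_sin {x y : ℝ} (hxy : |x| + |y| < 1) (n : ℕ) :
    2 * ∫ v in (0 : ℝ)..Real.pi / 2, Real.sin (Real.pi * y - 2 * y * v) *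
      (1 - Real.cos (2 * x * v)) * Real.sin (2 * (n + 1) * v) =
      Real.sin (Real.pi * y) * (poleTerm y n - poleTerm (y - x) n / 2 - poleTerm (x + y) n / 2) +
        Real.sin (Real.pi * x) / 2 * ((-1) ^ n * poleTerm (x + y) n -
          (-1) ^ n * poleTerm (y - x) n) := by
  have hy : |y| < 1 := by linarith [abs_nonneg x]
  have hd : |y - x| < 1 := by linarith [abs_sub y x]
  have hs : |x + y| < 1 := by linarith [abs_add_le x y]
  have hfun : ∀ v, Real.sin (Real.pi * y - 2 * y * v) * (1 - Real.cos (2 * x * v)) *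
      Real.sin (2 * (n + 1) * v) =
      Real.sin (Real.pi * y - 2 * y * v) * Real.sin (2 * (n + 1) * v) -
      (1 / 2 * (Real.sin (Real.pi * y - 2 * (y - x) * v) * Real.sin (2 * (n + 1) * v)) +
      1 / 2 * (Real.sin (Real.pi * y - 2 * (x + y) * v) * Real.sin (2 * (n + 1) * v))) := by
    intro v
    rw [show Real.pi * y - 2 * (y - x) * v = (Real.pi * y - 2 * y * v) + 2 * x * v by ring,
      show Real.pi * y - 2 * (x + y) * v = (Real.pi * y - 2 * y * v) - 2 * x * v by ring,
      Real.sin_add (Real.pi * y - 2 * y * v), Real.sin_sub (Real.pi * y - 2 * y * v)]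
    ring
  have hInt : ∀ w, IntervalIntegrable (fun v => Real.sin (Real.pi * y - 2 * w * v) *
      Real.sin (2 * (n + 1) * v)) volume 0 (Real.pi / 2) :=
    fun w => Continuous.intervalIntegrable (by fun_prop) _ _
  simp_rw [hfun]
  rw [intervalIntegral.integral_sub (hInt _) (((hInt _).const_mul _).add ((hInt _).const_mul _)),
    intervalIntegral.integral_add ((hInt _).const_mul _) ((hInt _).const_mul _),
    intervalIntegral.integral_const_mul, intervalIntegral.integral_const_mul,
    integral_sin_sub_mul_sin_succ _ hy, integral_sin_sub_mul_sin_succ _ hd,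
    integral_sin_sub_mul_sin_succ _ hs, sub_self, Real.sin_zero,
    show Real.pi * y - Real.pi * (y - x) = Real.pi * x by ring,
    show Real.pi * y - Real.pi * (x + y) = -(Real.pi * x) by ring, Real.sin_neg]
  ring

theorem intervalIntegrable_sin_mul_div_sin {x y : ℝ} (hx : 0 < x) (hx' : x ≤ 1 / 2) :
    IntervalIntegrable (fun v => Real.sin (Real.pi * y - 2 * y * v) *
      (1 - Real.cos (2 * x * v)) / Real.sin v) volume 0 (Real.pi / 2) := by
  have hpi := Real.pi_pos
  refine (intervalIntegrable_const (c := (2 : ℝ))).mono_fun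
    (Measurable.aestronglyMeasurable (by fun_prop)) ?_
  refine (ae_restrict_mem measurableSet_uIoc).mono fun v hv => ?_
  rw [Set.uIoc_of_le (by positivity)] at hv
  have hsin : 0 < Real.sin v := Real.sin_pos_of_pos_of_lt_pi hv.1 (by linarith [hv.2])
  have h := one_sub_cos_le_two_mul_sin hx hx' hv.1.le hv.2
  have h0 : 0 ≤ 1 - Real.cos (2 * x * v) := by linarith [Real.cos_le_one (2 * x * v)]
  beta_reduce
  rw [norm_div, norm_mul, Real.norm_of_nonneg hsin.le, Real.norm_of_nonneg h0,
    div_le_iff₀ hsin, Real.norm_two, Real.norm_eq_abs]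
  calc _ ≤ 1 * (2 * Real.sin v) := by
        gcongr
        exact Real.abs_sin_le_one _
    _ = _ := one_mul _

theorem integral_eq_poleSum {x y : ℝ} (hx : 0 < x) (hx' : x ≤ 1 / 2) (hxy : |x| + |y| < 1) :
    ∫ v in (0 : ℝ)..Real.pi / 2, Real.sin (Real.pi * y - 2 * y * v) *
      (1 - Real.cos (2 * x * v)) / Real.sin v * Real.cos v =
      Real.sin (Real.pi * y) * (poleSum y - poleSum (y - x) / 2 - poleSum (x + y) / 2) +
        Real.sin (Real.pi * x) / 2 * (altPoleSum (x + y) - altPoleSum (y - x)) := by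
  have hpi := Real.pi_pos
  have hy : |y| < 1 := by linarith [abs_nonneg x]
  have hd : |y - x| < 1 := by linarith [abs_sub y x]
  have hs : |x + y| < 1 := by linarith [abs_add_le x y]
  have hg := intervalIntegrable_sin_mul_div_sin (y := y) hx hx'
  have hsum := ((((hasSum_poleTerm hy).sub ((hasSum_poleTerm hd).div_const 2)).sub
    ((hasSum_poleTerm hs).div_const 2)).mul_left (Real.sin (Real.pi * y))).add
    (((hasSum_alt_poleTerm hs).sub (hasSum_alt_poleTerm hd)).mul_left (Real.sin (Real.pi * x) / 2))
  refine tendsto_nhds_unique ?_ hsum.tendsto_sum_nat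
  have hRL := (tendsto_integral_mul_cos_odd (by positivity) hg).const_sub
    (∫ v in (0 : ℝ)..Real.pi / 2, Real.sin (Real.pi * y - 2 * y * v) *
      (1 - Real.cos (2 * x * v)) / Real.sin v * Real.cos v)
  rw [sub_zero] at hRL
  refine hRL.congr fun N => ?_
  have hcont : ∀ n : ℕ, IntervalIntegrable (fun v => Real.sin (Real.pi * y - 2 * y * v) *
      (1 - Real.cos (2 * x * v)) * Real.sin (2 * (n + 1) * v)) volume 0 (Real.pi / 2) :=
    fun n => Continuous.intervalIntegrable (by fun_prop) _ _
  rw [← Finset.sum_congr rfl fun n _ => two_mul_integral_mul_sin hxy n, ← Finset.mul_sum,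
    ← intervalIntegral.integral_finsetSum fun n _ => hcont n,
    ← intervalIntegral.integral_const_mul,
    ← intervalIntegral.integral_sub (hg.mul_continuousOn (by fun_prop))
      (hg.mul_continuousOn (by fun_prop))]
  refine intervalIntegral.integral_congr_ae (Eventually.of_forall fun v hv => ?_)
  rw [Set.uIoc_of_le (by positivity)] at hv
  have hsin : Real.sin v ≠ 0 := (Real.sin_pos_of_pos_of_lt_pi hv.1 (by linarith [hv.2])).ne'
  rw [← mul_sub, ← two_mul_sum_sin_mul_sin, ← Finset.mul_sum]
  field_simp

theorem HasSum.sum_antidiagonal {f : ℕ × ℕ → ℝ} {S : ℝ} (hf : HasSum f S) :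
    HasSum (fun n => ∑ p ∈ Finset.HasAntidiagonal.antidiagonal n, f p) S := by
  have h := (Finset.HasAntidiagonal.sigmaAntidiagonalEquivProd (A := ℕ)).hasSum_iff.mpr hf
  refine h.sigma fun n => ?_
  rw [← Finset.sum_coe_sort]
  exact hasSum_fintype _

theorem hasSum_of_hasSum_antidiagonal {f : ℕ × ℕ → ℝ} {S : ℝ} (hf : ∀ p, 0 ≤ f p)
    (h : HasSum (fun n => ∑ p ∈ Finset.HasAntidiagonal.antidiagonal n, f p) S) : HasSum f S := by
  have hs : Summable f := by
    rw [← (Finset.HasAntidiagonal.sigmaAntidiagonalEquivProd (A := ℕ)).summable_iff]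
    refine (summable_sigma_of_nonneg fun _ => hf _).mpr
      ⟨fun n => (hasSum_fintype _).summable, h.summable.congr fun n => ?_⟩
    rw [tsum_fintype, ← Finset.sum_coe_sort]
    rfl
  rw [← hs.hasSum.sum_antidiagonal.unique h]
  exact hs.hasSum

/-- Splitting the second index of `(a, b)` as a sum. -/
def sigmaAntidiagonalSndEquiv :
    (Σ p : ℕ × ℕ, Finset.HasAntidiagonal.antidiagonal p.2) ≃ (ℕ × ℕ) × ℕ where
  toFun q := ((q.1.1, q.2.1.1), q.2.1.2)
  invFun q := ⟨(q.1.1, q.1.2 + q.2),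
    ⟨(q.1.2, q.2), Finset.HasAntidiagonal.mem_antidiagonal.mpr rfl⟩⟩
  left_inv := by
    rintro ⟨⟨a, b⟩, ⟨⟨c, j⟩, h⟩⟩
    obtain rfl := Finset.HasAntidiagonal.mem_antidiagonal.mp h
    rfl
  right_inv _ := rfl

theorem HasSum.mul_sum_antidiagonal_snd {u : ℕ × ℕ → ℝ} {v : ℕ → ℝ} {U V : ℝ} (hu : HasSum u U)
    (hv : HasSum v V) (hv' : Summable fun j => ‖v j‖) :
    HasSum (fun p : ℕ × ℕ => ∑ q ∈ Finset.HasAntidiagonal.antidiagonal p.2,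
      u (p.1, q.1) * v q.2) (U * V) := by
  have h := sigmaAntidiagonalSndEquiv.hasSum_iff.mpr
    (hu.mul hv (summable_mul_of_summable_norm hu.summable.norm hv'))
  refine h.sigma fun p => ?_
  rw [← Finset.sum_coe_sort]
  exact hasSum_fintype _

theorem sum_range_two_mul_add_one (f : ℕ → ℝ) (n : ℕ) :
    ∑ m ∈ Finset.range (2 * n + 1), f m =
      ∑ k ∈ Finset.range (n + 1), f (2 * k) + ∑ k ∈ Finset.range n, f (2 * k + 1) := by
  induction n with
  | zero => simp
  | succ n ih =>
    rw [show 2 * (n + 1) + 1 = 2 * n + 1 + 1 + 1 by ring, Finset.sum_range_succ,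
      Finset.sum_range_succ, ih, Finset.sum_range_succ (fun k => f (2 * k)) (n + 1),
      Finset.sum_range_succ (fun k => f (2 * k + 1)) n,
      show 2 * n + 1 + 1 = 2 * (n + 1) by ring]
    ring

theorem add_pow_two_mul (x y : ℝ) (n : ℕ) :
    (x + y) ^ (2 * n) =
      ∑ k ∈ Finset.range (n + 1), x ^ (2 * k) * y ^ (2 * n - 2 * k) * (2 * n).choose (2 * k) +
      ∑ k ∈ Finset.range n,
        x ^ (2 * k + 1) * y ^ (2 * n - (2 * k + 1)) * (2 * n).choose (2 * k + 1) := by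
  rw [add_pow, sum_range_two_mul_add_one]

theorem sub_pow_two_mul (x y : ℝ) (n : ℕ) :
    (y - x) ^ (2 * n) =
      ∑ k ∈ Finset.range (n + 1), x ^ (2 * k) * y ^ (2 * n - 2 * k) * (2 * n).choose (2 * k) -
      ∑ k ∈ Finset.range n,
        x ^ (2 * k + 1) * y ^ (2 * n - (2 * k + 1)) * (2 * n).choose (2 * k + 1) := by
  rw [show y - x = -x + y by ring, add_pow_two_mul, sub_eq_add_neg, ← Finset.sum_neg_distrib]
  congr 1
  · refine Finset.sum_congr rfl fun k _ => ?_
    rw [(even_two_mul k).neg_pow]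
  · refine Finset.sum_congr rfl fun k _ => ?_
    rw [(odd_two_mul_add_one k).neg_pow]
    ring

theorem sum_antidiagonal_choose_even (x y : ℝ) (s : ℕ) :
    ∑ p ∈ Finset.HasAntidiagonal.antidiagonal s, 2 * ((2 * (s + 1)).choose (2 * p.1 + 2) : ℝ) *
      x ^ (2 * p.1 + 2) * y ^ (2 * p.2) =
      (x + y) ^ (2 * (s + 1)) + (y - x) ^ (2 * (s + 1)) - 2 * y ^ (2 * (s + 1)) := by
  rw [add_pow_two_mul, sub_pow_two_mul, Finset.sum_range_succ',
    Finset.Nat.sum_antidiagonal_eq_sum_range_succ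
    (fun a c => 2 * ((2 * (s + 1)).choose (2 * a + 2) : ℝ) * x ^ (2 * a + 2) * y ^ (2 * c))]
  have h : ∑ k ∈ Finset.range (s + 1), 2 * ((2 * (s + 1)).choose (2 * k + 2) : ℝ) *
      x ^ (2 * k + 2) * y ^ (2 * (s - k)) = 2 * ∑ k ∈ Finset.range (s + 1),
        x ^ (2 * (k + 1)) * y ^ (2 * (s + 1) - 2 * (k + 1)) *
          (2 * (s + 1)).choose (2 * (k + 1)) := by
    rw [Finset.mul_sum]
    refine Finset.sum_congr rfl fun k _ => ?_
    rw [show 2 * (s + 1) - 2 * (k + 1) = 2 * (s - k) by omega, show 2 * (k + 1) = 2 * k + 2 by ring]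
    ring
  rw [h]
  simp only [mul_zero, pow_zero, Nat.choose_zero_right, Nat.cast_one, tsub_zero]
  ring

theorem sum_antidiagonal_choose_odd (x y : ℝ) (s : ℕ) :
    ∑ p ∈ Finset.HasAntidiagonal.antidiagonal s, 2 * ((2 * (s + 1)).choose (2 * p.1 + 1) : ℝ) *
      y ^ (2 * p.1 + 1) * x ^ (2 * p.2 + 1) =
      (x + y) ^ (2 * (s + 1)) - (y - x) ^ (2 * (s + 1)) := by
  rw [add_comm x y, ← neg_sub x y, (even_two_mul (s + 1)).neg_pow, add_pow_two_mul,
    sub_pow_two_mul, Finset.Nat.sum_antidiagonal_eq_sum_range_succ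
    (fun a c => 2 * ((2 * (s + 1)).choose (2 * a + 1) : ℝ) * y ^ (2 * a + 1) * x ^ (2 * c + 1)),
    add_sub_sub_cancel, ← two_mul, Finset.mul_sum]
  refine Finset.sum_congr rfl fun k hk => ?_
  rw [Finset.mem_range] at hk
  rw [show 2 * (s + 1) - (2 * k + 1) = 2 * (s - k) + 1 by omega]
  ring

theorem riemannZetaReal_nonneg (k : ℕ) : 0 ≤ riemannZetaReal k :=
  tsum_nonneg fun _ => by positivity

theorem hasSum_choose_even {x y : ℝ} (hx : 0 < x) (hy : 0 < y) (hxy : x + y < 1) :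
    HasSum (fun p : ℕ × ℕ => 2 * ((2 * (p.1 + p.2 + 1)).choose (2 * p.1 + 2) : ℝ) *
      x ^ (2 * p.1 + 2) * y ^ (2 * p.2) * riemannZetaReal (2 * (p.1 + p.2 + 1) + 1))
      (poleSum (x + y) + poleSum (y - x) - 2 * poleSum y) := by
  refine hasSum_of_hasSum_antidiagonal (fun p => ?_) ?_
  · have := riemannZetaReal_nonneg (2 * (p.1 + p.2 + 1) + 1)
    positivity
  have h1 := hasSum_zeta_mul_pow (z := x + y) (by rw [abs_lt]; constructor <;> linarith)
  have h2 := hasSum_zeta_mul_pow (z := y - x) (by rw [abs_lt]; constructor <;> linarith)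
  have h3 := hasSum_zeta_mul_pow (z := y) (by rw [abs_lt]; constructor <;> linarith)
  refine ((h1.add h2).sub (h3.mul_left 2)).congr_fun fun s => ?_
  have e := sum_antidiagonal_choose_even x y s
  rw [Finset.sum_congr rfl (g := fun p => 2 * ((2 * (s + 1)).choose (2 * p.1 + 2) : ℝ) *
      x ^ (2 * p.1 + 2) * y ^ (2 * p.2) * riemannZetaReal (2 * (s + 1) + 1))
      fun p hp => by rw [Finset.HasAntidiagonal.mem_antidiagonal.mp hp], ← Finset.sum_mul, e]
  ring

theorem hasSum_choose_odd {x y : ℝ} (hx : 0 < x) (hy : 0 < y) (hxy : x + y < 1) :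
    HasSum (fun p : ℕ × ℕ => 2 * ((2 * (p.1 + p.2 + 1)).choose (2 * p.1 + 1) : ℝ) *
      y ^ (2 * p.1 + 1) * x ^ (2 * p.2 + 1) * ((1 - 1 / 2 ^ (2 * (p.1 + p.2 + 1))) *
        riemannZetaReal (2 * (p.1 + p.2 + 1) + 1)))
      (altPoleSum (x + y) - altPoleSum (y - x)) := by
  refine hasSum_of_hasSum_antidiagonal (fun p => ?_) ?_
  · have := riemannZetaReal_nonneg (2 * (p.1 + p.2 + 1) + 1)
    have h2 : (0 : ℝ) ≤ 1 - 1 / 2 ^ (2 * (p.1 + p.2 + 1)) := by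
      rw [sub_nonneg, div_le_one (by positivity)]
      exact one_le_pow₀ one_le_two
    positivity
  have h1 := hasSum_alt_zeta_mul_pow (z := x + y) (by rw [abs_lt]; constructor <;> linarith)
  have h2 := hasSum_alt_zeta_mul_pow (z := y - x) (by rw [abs_lt]; constructor <;> linarith)
  refine (h1.sub h2).congr_fun fun s => ?_
  have e := sum_antidiagonal_choose_odd x y s
  rw [Finset.sum_congr rfl (g := fun p => 2 * ((2 * (s + 1)).choose (2 * p.1 + 1) : ℝ) *
      y ^ (2 * p.1 + 1) * x ^ (2 * p.2 + 1) * ((1 - 1 / 2 ^ (2 * (s + 1))) *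
        riemannZetaReal (2 * (s + 1) + 1)))
      fun p hp => by rw [Finset.HasAntidiagonal.mem_antidiagonal.mp hp], ← Finset.sum_mul, e]
  ring

theorem sum_Icc_eq_sum_antidiagonal {f : ℕ → ℝ} {n a b : ℕ} (hn : n = a + b + 1)
    (hf : ∀ r ≤ a, f r = 0) :
    ∑ r ∈ Finset.Icc 1 n, f r = ∑ q ∈ Finset.HasAntidiagonal.antidiagonal b, f (a + q.1 + 1) := by
  subst hn
  rw [Finset.Nat.sum_antidiagonal_eq_sum_range_succ (fun c _ => f (a + c + 1)),
    ← Finset.sum_subset (s₁ := Finset.Ico (a + 1) (a + b + 2)),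
    Finset.sum_Ico_eq_sum_range, show a + b + 2 - (a + 1) = b.succ by omega]
  · exact Finset.sum_congr rfl fun k _ => by rw [add_right_comm]
  · intro r hr
    simp only [Finset.mem_Ico, Finset.mem_Icc] at hr ⊢
    omega
  · intro r hr hr'
    simp only [Finset.mem_Ico, Finset.mem_Icc] at hr hr'
    exact hf r (by omega)

theorem Hhat_term_eq (a b : ℕ) (x y : ℝ) :
    (-1) ^ (a + b + 1) * Hhat a b * x ^ (2 * a + 2) * y ^ (2 * b + 1) =
      ∑ q ∈ Finset.HasAntidiagonal.antidiagonal b,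
        (2 * ((2 * (a + q.1 + 1)).choose (2 * a + 2) : ℝ) *
        x ^ (2 * a + 2) * y ^ (2 * q.1) * riemannZetaReal (2 * (a + q.1 + 1) + 1)) *
        (y * ((-1) ^ q.2 * twosTail q.2 0 * y ^ (2 * q.2))) -
      ∑ q ∈ Finset.HasAntidiagonal.antidiagonal a,
        (2 * ((2 * (b + q.1 + 1)).choose (2 * b + 1) : ℝ) *
        y ^ (2 * b + 1) * x ^ (2 * q.1 + 1) * ((1 - 1 / 2 ^ (2 * (b + q.1 + 1))) *
          riemannZetaReal (2 * (b + q.1 + 1) + 1))) *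
        (x * ((-1) ^ q.2 * twosTail q.2 0 * x ^ (2 * q.2))) := by
  have hsplit : Hhat a b =
      ∑ r ∈ Finset.Icc 1 (a + b + 1), 2 * ((-1) ^ r * (2 * r).choose (2 * a + 2) *
        riemannZetaReal (2 * r + 1) * twosTail (a + b + 1 - r) 0) -
      ∑ r ∈ Finset.Icc 1 (a + b + 1), 2 * ((-1) ^ r * ((1 - 1 / 2 ^ (2 * r)) *
        (2 * r).choose (2 * b + 1)) * riemannZetaReal (2 * r + 1) *
          twosTail (a + b + 1 - r) 0) := by
    rw [Hhat, Finset.mul_sum, ← Finset.sum_sub_distrib]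
    refine Finset.sum_congr rfl fun r _ => ?_
    rw [mzv_two_eq, cCoeff]
    ring
  rw [hsplit, sum_Icc_eq_sum_antidiagonal rfl, sum_Icc_eq_sum_antidiagonal (a := b) (b := a),
    mul_sub, sub_mul, sub_mul]
  · congr 1
    · rw [Finset.mul_sum, Finset.sum_mul, Finset.sum_mul]
      refine Finset.sum_congr rfl fun q hq => ?_
      rw [← Finset.HasAntidiagonal.mem_antidiagonal.mp hq,
        show a + (q.1 + q.2) + 1 - (a + q.1 + 1) = q.2 by omega,
        show a + (q.1 + q.2) + 1 = (a + q.1 + 1) + q.2 by ring, pow_add (-1 : ℝ)]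
      have hsq : ((-1 : ℝ) ^ (a + q.1 + 1)) ^ 2 = 1 := by rw [← pow_mul, mul_comm, pow_mul]; simp
      linear_combination (2 * ((2 * (a + q.1 + 1)).choose (2 * a + 2) : ℝ) *
        x ^ (2 * a + 2) * y ^ (2 * (q.1 + q.2) + 1) * riemannZetaReal (2 * (a + q.1 + 1) + 1) *
        (-1) ^ q.2 * twosTail q.2 0) * hsq
    · rw [Finset.mul_sum, Finset.sum_mul, Finset.sum_mul]
      refine Finset.sum_congr rfl fun q hq => ?_
      rw [← Finset.HasAntidiagonal.mem_antidiagonal.mp hq,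
        show q.1 + q.2 + b + 1 - (b + q.1 + 1) = q.2 by omega,
        show q.1 + q.2 + b + 1 = (b + q.1 + 1) + q.2 by ring, pow_add (-1 : ℝ)]
      have hsq : ((-1 : ℝ) ^ (b + q.1 + 1)) ^ 2 = 1 := by rw [← pow_mul, mul_comm, pow_mul]; simp
      linear_combination (2 * ((2 * (b + q.1 + 1)).choose (2 * b + 1) : ℝ) *
        y ^ (2 * b + 1) * x ^ (2 * (q.1 + q.2) + 2) * ((1 - 1 / 2 ^ (2 * (b + q.1 + 1))) *
          riemannZetaReal (2 * (b + q.1 + 1) + 1)) *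
        (-1) ^ q.2 * twosTail q.2 0) * hsq
  · ring
  · intro r hr
    rw [Nat.choose_eq_zero_of_lt (by omega)]
    simp
  · intro r hr
    rw [Nat.choose_eq_zero_of_lt (by omega)]
    simp

theorem hasSum_mul_twosGen {y : ℝ} (hy : 2 * y ^ 2 < 1) :
    HasSum (fun j => y * ((-1) ^ j * twosTail j 0 * y ^ (2 * j)))
      (Real.sin (Real.pi * y) / Real.pi) := by
  rw [← pi_mul_twosGen_zero hy, mul_assoc, mul_div_cancel_left₀ _ Real.pi_ne_zero]
  exact (hasSum_twosGen hy 0).mul_left y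

theorem summable_norm_mul_twosGen_term {y : ℝ} (hy : 2 * y ^ 2 < 1) :
    Summable fun j => ‖y * ((-1) ^ j * twosTail j 0 * y ^ (2 * j))‖ := by
  simp_rw [norm_mul y]
  exact (summable_norm_twosGen_term hy 0).mul_left _

theorem hasSum_Hhat {x y : ℝ} (hx : 0 < x) (hy : 0 < y) (hx' : x < 1 / 4) (hy' : y < 1 / 4) :
    HasSum (fun p : ℕ × ℕ => (-1) ^ (p.1 + p.2 + 1) * Hhat p.1 p.2 * x ^ (2 * p.1 + 2) *
      y ^ (2 * p.2 + 1))
      ((poleSum (x + y) + poleSum (y - x) - 2 * poleSum y) * (Real.sin (Real.pi * y) / Real.pi) -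
        (altPoleSum (x + y) - altPoleSum (y - x)) * (Real.sin (Real.pi * x) / Real.pi)) := by
  have hx2 : 2 * x ^ 2 < 1 := by nlinarith
  have hy2 : 2 * y ^ 2 < 1 := by nlinarith
  have h1 := (hasSum_choose_even hx hy (by linarith)).mul_sum_antidiagonal_snd
    (hasSum_mul_twosGen hy2) (summable_norm_mul_twosGen_term hy2)
  have h2 := (Equiv.prodComm ℕ ℕ).hasSum_iff.mpr <|
    (hasSum_choose_odd hx hy (by linarith)).mul_sum_antidiagonal_snd
    (hasSum_mul_twosGen hx2) (summable_norm_mul_twosGen_term hx2)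
  exact (h1.sub h2).congr_fun fun p => Hhat_term_eq p.1 p.2 x y

theorem hasSum_Hmzv {x y : ℝ} (hx : 0 < x) (hy : 0 < y) (hx' : x < 1 / 4) (hy' : y < 1 / 4) :
    HasSum (fun p : ℕ × ℕ => (-1) ^ (p.1 + p.2 + 1) * Hmzv p.1 p.2 * x ^ (2 * p.1 + 2) *
      y ^ (2 * p.2 + 1))
      ((poleSum (x + y) + poleSum (y - x) - 2 * poleSum y) * (Real.sin (Real.pi * y) / Real.pi) -
        (altPoleSum (x + y) - altPoleSum (y - x)) * (Real.sin (Real.pi * x) / Real.pi)) := by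
  have hx2 : 2 * x ^ 2 < 1 := by nlinarith
  have hy2 : 2 * y ^ 2 < 1 := by nlinarith
  have hI := (integral_eq_hGen hx (by linarith) hy2 hy.ne').symm.trans
    (integral_eq_poleSum hx (by linarith) (by rw [abs_of_pos hx, abs_of_pos hy]; linarith))
  have hval : (poleSum (x + y) + poleSum (y - x) - 2 * poleSum y) *
      (Real.sin (Real.pi * y) / Real.pi) - (altPoleSum (x + y) - altPoleSum (y - x)) *
      (Real.sin (Real.pi * x) / Real.pi) = -(x ^ 2 * y) * hGen x y 0 := by
    have := Real.pi_ne_zero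
    field_simp
    rw [mul_comm y, mul_comm x Real.pi]
    linarith
  rw [hval]
  refine ((hasSum_hGen hx2 hy2).mul_left (-(x ^ 2 * y))).congr_fun fun p => ?_
  rw [Hmzv_eq]
  ring

theorem coeff_zero_eq_zero_of_hasSum {c : ℕ → ℝ} {ε : ℝ} (hε : 0 < ε)
    (h : ∀ t, 0 < t → t < ε → HasSum (fun n => c n * t ^ (2 * n)) 0) : c 0 = 0 := by
  have hs := (h (ε / 2) (by positivity) (by linarith)).summable.norm
  have hlim : Tendsto (fun t : ℝ => ∑' n, c n * t ^ (2 * n)) (𝓝[>] 0)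
      (𝓝 (∑' n, c n * 0 ^ (2 * n))) := by
    refine tendsto_tsum_of_dominated_convergence hs (fun n => ?_) ?_
    · exact ((by fun_prop : Continuous fun t : ℝ => c n * t ^ (2 * n)).tendsto 0).mono_left
        nhdsWithin_le_nhds
    · filter_upwards [Ioo_mem_nhdsGT (half_pos hε)] with t ht n
      rw [norm_mul, norm_mul, norm_pow, norm_pow, Real.norm_of_nonneg ht.1.le,
        Real.norm_of_nonneg (half_pos hε).le]
      have := ht.1.le
      have := ht.2.le
      gcongr
  have hzero : Tendsto (fun t : ℝ => ∑' n, c n * t ^ (2 * n)) (𝓝[>] 0) (𝓝 0) := by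
    refine tendsto_const_nhds.congr' ?_
    filter_upwards [Ioo_mem_nhdsGT hε] with t ht
    exact (h t ht.1 ht.2).tsum_eq.symm
  have := tendsto_nhds_unique hlim hzero
  rwa [tsum_eq_single 0 fun n hn => by simp [hn], mul_zero, pow_zero, mul_one] at this

theorem coeff_eq_zero_of_hasSum {c : ℕ → ℝ} {ε : ℝ} (hε : 0 < ε)
    (h : ∀ t, 0 < t → t < ε → HasSum (fun n => c n * t ^ (2 * n)) 0) (n : ℕ) : c n = 0 := by
  induction n using Nat.strong_induction_on with
  | _ n ih =>
    have hshift := coeff_zero_eq_zero_of_hasSum (c := fun k => c (k + n)) hε fun t ht ht' => by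
      have hsub := (hasSum_nat_add_iff' n).mpr (h t ht ht')
      rw [Finset.sum_eq_zero fun k hk => by rw [ih k (Finset.mem_range.mp hk), zero_mul],
        sub_zero] at hsub
      have hdiv := hsub.div_const (t ^ (2 * n))
      rw [zero_div] at hdiv
      refine hdiv.congr_fun fun k => ?_
      rw [mul_add, pow_add]
      field_simp
    simpa using hshift

theorem coeff_eq_zero_of_hasSum_prod {d : ℕ × ℕ → ℝ} {ε : ℝ} (hε : 0 < ε)
    (h : ∀ x y, 0 < x → 0 < y → x < ε → y < ε →
      HasSum (fun p : ℕ × ℕ => d p * x ^ (2 * p.1) * y ^ (2 * p.2)) 0) (p : ℕ × ℕ) : d p = 0 := by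
  obtain ⟨a, b⟩ := p
  refine coeff_eq_zero_of_hasSum (c := fun b => d (a, b)) hε (fun y hy hy' => ?_) b
  have hrow : ∀ a, Summable fun b => d (a, b) * y ^ (2 * b) := fun a => by
    have hs := ((h (ε / 2) y (by positivity) hy (by linarith) hy').summable.prod_factor a).div_const
      ((ε / 2) ^ (2 * a))
    refine hs.congr fun b => ?_
    field_simp
  have hzero := coeff_eq_zero_of_hasSum (c := fun a => ∑' b, d (a, b) * y ^ (2 * b)) hε
    (fun x hx hx' => (h x y hx hy hx' hy').prod_fiberwise fun a =>
      ((hrow a).hasSum.mul_right (x ^ (2 * a))).congr_fun fun b => by ring) a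
  exact hzero ▸ (hrow a).hasSum

/-- Zagier's formula for `ζ(2,…,2,3,2,…,2)`. -/
theorem Hmzv_eq_Hhat (a b : ℕ) : Hmzv a b = Hhat a b := by
  have h := coeff_eq_zero_of_hasSum_prod
    (d := fun p => (-1) ^ (p.1 + p.2 + 1) * (Hmzv p.1 p.2 - Hhat p.1 p.2))
    (ε := 1 / 4) (by norm_num) (fun x y hx hy hx' hy' => by
      have hsub := ((hasSum_Hmzv hx hy hx' hy').sub (hasSum_Hhat hx hy hx' hy')).div_const
        (x ^ 2 * y)
      rw [sub_self, zero_div] at hsub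
      refine hsub.congr_fun fun p => ?_
      field_simp
      ring) (a, b)
  rcases mul_eq_zero.mp h with h | h
  · exact absurd h (pow_ne_zero _ (by norm_num))
  · exact sub_eq_zero.mp h

theorem Fgen_eq_FhatGen (x y : ℝ) (hx : |x| < 1) (hy : |y| < 1) :
    Fgen x y = FhatGen x y := by
  simp only [Fgen, FhatGen, Hmzv_eq_Hhat]
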